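/- There exists a constant R₁ > 0 independent of ε such that diam(A_ε) ≥ R₁ ε for all sufficiently small ε > 0. -/

import Mathlib

open MeasureTheory Real Filter Topology Set

noncomputable section

/-- The bilinear form `(K_H(x) a | b)` associated with the matrix
`K_H(x) = (k²+|x|²)⁻¹ [[k²+x₂², -x₁x₂],[-x₁x₂, k²+x₁²]]`. -/
def KHform (k : ℝ) (x a b : ℝ × ℝ) : ℝ :=
  (k ^ 2 + x.1 ^ 2 + x.2 ^ 2)⁻¹ *
    ((k ^ 2 + x.2 ^ 2) * a.1 * b.1 - x.1 * x.2 * a.1 * b.2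
      - x.1 * x.2 * a.2 * b.1 + (k ^ 2 + x.1 ^ 2) * a.2 * b.2)

/-- `K_H(x)` applied to a vector `a`. -/
def KHvec (k : ℝ) (x a : ℝ × ℝ) : ℝ × ℝ :=
  ((k ^ 2 + x.1 ^ 2 + x.2 ^ 2)⁻¹ * ((k ^ 2 + x.2 ^ 2) * a.1 - x.1 * x.2 * a.2),
   (k ^ 2 + x.1 ^ 2 + x.2 ^ 2)⁻¹ * (-(x.1 * x.2) * a.1 + (k ^ 2 + x.1 ^ 2) * a.2))

/-- `det K_H(x) = k²/(k²+|x|²)`. -/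
def detKH (k : ℝ) (x : ℝ × ℝ) : ℝ := k ^ 2 / (k ^ 2 + x.1 ^ 2 + x.2 ^ 2)

/-- Gradient of a scalar function on `ℝ²`. -/
def grad (u : ℝ × ℝ → ℝ) (x : ℝ × ℝ) : ℝ × ℝ :=
  (fderiv ℝ u x (1, 0), fderiv ℝ u x (0, 1))

/-- Divergence of a vector field on `ℝ²`. -/
def div2 (F : ℝ × ℝ → ℝ × ℝ) (x : ℝ × ℝ) : ℝ :=
  fderiv ℝ (fun y => (F y).1) x (1, 0) + fderiv ℝ (fun y => (F y).2) x (0, 1)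

/-- The operator `L_H u = -div (K_H(x) ∇u)`. -/
def LH (k : ℝ) (u : ℝ × ℝ → ℝ) (x : ℝ × ℝ) : ℝ :=
  - div2 (fun y => KHvec k y (grad u y)) x

/-- Positive part `t₊ = max (t, 0)`. -/
def pPart (t : ℝ) : ℝ := max t 0

/-- Clockwise rotation through `π/2`: `a^⊥`. -/
def perp2 (a : ℝ × ℝ) : ℝ × ℝ := (a.2, -a.1)

/-- Euclidean distance in the plane. -/
def dE (a b : ℝ × ℝ) : ℝ := Real.sqrt ((a.1 - b.1) ^ 2 + (a.2 - b.2) ^ 2)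

/-- Euclidean diameter of a planar set. -/
def diamE (S : Set (ℝ × ℝ)) : ℝ := sSup {d | ∃ a ∈ S, ∃ b ∈ S, d = dE a b}

/-- Euclidean distance between two planar sets. -/
def distE (A B : Set (ℝ × ℝ)) : ℝ := sInf {d | ∃ a ∈ A, ∃ b ∈ B, d = dE a b}

/-- The function `q² √(det K_H)`. -/
def Qfun (k : ℝ) (q : ℝ × ℝ → ℝ) (x : ℝ × ℝ) : ℝ := q x ^ 2 * Real.sqrt (detKH k x)

/-- Surrogate for membership in `H(Ω) = H¹₀(Ω)` (with equivalent norm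
`‖u‖² = ∫_Ω (K_H ∇u|∇u)`). -/
def MemH (k : ℝ) (Ω : Set (ℝ × ℝ)) (u : ℝ × ℝ → ℝ) : Prop :=
  ContinuousOn u (closure Ω) ∧ ContDiffOn ℝ 1 u Ω ∧ (∀ x ∈ frontier Ω, u x = 0) ∧
    IntegrableOn (fun x => KHform k x (grad u x) (grad u x)) Ω

/-- The energy functional `I_ε`. -/
def Ieps (k p ε : ℝ) (q : ℝ × ℝ → ℝ) (Ω : Set (ℝ × ℝ)) (u : ℝ × ℝ → ℝ) : ℝ :=
  (1 / 2) * (∫ x in Ω, KHform k x (grad u x) (grad u x))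
    - (1 / ((p + 1) * ε ^ 2)) * ∫ x in Ω, pPart (u x - q x * Real.log (1 / ε)) ^ (p + 1)

/-- The mountain pass value `c_ε = inf_{γ ∈ P_ε} max_{t ∈ [0,1]} I_ε(γ(t))`, where
`P_ε` is the collection of paths in `H(Ω)` (continuous for the `H`-norm) joining `0`
to a point with negative energy. -/
def ceps (k p : ℝ) (q : ℝ × ℝ → ℝ) (Ω : Set (ℝ × ℝ)) (ε : ℝ) : ℝ :=
  sInf {c | ∃ γ : ℝ → ℝ × ℝ → ℝ,
    (∀ t ∈ Icc (0:ℝ) 1, MemH k Ω (γ t)) ∧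
    (∀ t ∈ Icc (0:ℝ) 1, ∀ δ > 0, ∃ η > 0, ∀ s ∈ Icc (0:ℝ) 1, |s - t| < η →
      (∫ x in Ω, KHform k x (grad (fun y => γ s y - γ t y) x)
        (grad (fun y => γ s y - γ t y) x)) < δ) ∧
    γ 0 = (fun _ => 0) ∧ Ieps k p ε q Ω (γ 1) < 0 ∧
    c = sSup ((fun t => Ieps k p ε q Ω (γ t)) '' Icc (0:ℝ) 1)}

/-- The Nehari manifold `N_ε`. -/
def Nehari (k p ε : ℝ) (q : ℝ × ℝ → ℝ) (Ω : Set (ℝ × ℝ)) : Set (ℝ × ℝ → ℝ) :=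
  {u | MemH k Ω u ∧ ¬ Set.EqOn u 0 Ω ∧
    (∫ x in Ω, KHform k x (grad u x) (grad u x))
      = (1 / ε ^ 2) * ∫ x in Ω, pPart (u x - q x * Real.log (1 / ε)) ^ p * u x}

/-- `u` is a (classical) solution of `L_H u = ε⁻²(u - q ln(1/ε))₊ᵖ` in `Ω`, `u = 0` on `∂Ω`. -/
def IsSolution (k p ε : ℝ) (q : ℝ × ℝ → ℝ) (Ω : Set (ℝ × ℝ)) (u : ℝ × ℝ → ℝ) : Prop :=
  ContinuousOn u (closure Ω) ∧ ContDiffOn ℝ 2 u Ω ∧ (∀ x ∈ frontier Ω, u x = 0) ∧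
    ∀ x ∈ Ω, LH k u x = (1 / ε ^ 2) * pPart (u x - q x * Real.log (1 / ε)) ^ p

/-- `u` is a mountain pass solution: a solution at the mountain pass level `c_ε`. -/
def IsMPSolution (k p ε : ℝ) (q : ℝ × ℝ → ℝ) (Ω : Set (ℝ × ℝ)) (u : ℝ × ℝ → ℝ) : Prop :=
  IsSolution k p ε q Ω u ∧ MemH k Ω u ∧ Ieps k p ε q Ω u = ceps k p q Ω ε

/-- The vortex core `A_ε = {x ∈ Ω : u(x) > q(x) ln(1/ε)}`. -/
def vcore (q : ℝ × ℝ → ℝ) (Ω : Set (ℝ × ℝ)) (ε : ℝ) (u : ℝ × ℝ → ℝ) : Set (ℝ × ℝ) :=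
  {x ∈ Ω | q x * Real.log (1 / ε) < u x}

/-! ### Algebra of the form -/

lemma KHform_eq_vec (k : ℝ) (x a b : ℝ × ℝ) :
    KHform k x a b = (KHvec k x a).1 * b.1 + (KHvec k x a).2 * b.2 := by
  simp only [KHform, KHvec]; ring

lemma KH_den_pos {k : ℝ} (hk : 0 < k) (x : ℝ × ℝ) : 0 < k ^ 2 + x.1 ^ 2 + x.2 ^ 2 := by
  positivity

lemma KHform_self_le {k : ℝ} (hk : 0 < k) (x a : ℝ × ℝ) :
    KHform k x a a ≤ a.1 ^ 2 + a.2 ^ 2 := by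
  have h := KH_den_pos hk x
  rw [KHform, inv_mul_le_iff₀ h]
  nlinarith [sq_nonneg (x.1 * a.1 + x.2 * a.2)]

lemma KHform_self_ge {k : ℝ} (hk : 0 < k) (x a : ℝ × ℝ) :
    k ^ 2 * (a.1 ^ 2 + a.2 ^ 2) ≤ (k ^ 2 + x.1 ^ 2 + x.2 ^ 2) * KHform k x a a := by
  have h := KH_den_pos hk x
  rw [KHform, mul_inv_cancel_left₀ h.ne']
  nlinarith [sq_nonneg (x.2 * a.1 - x.1 * a.2)]

lemma KHform_self_nonneg {k : ℝ} (hk : 0 < k) (x a : ℝ × ℝ) : 0 ≤ KHform k x a a := by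
  have h := KH_den_pos hk x
  have h1 := KHform_self_ge hk x a
  by_contra hc
  push Not at hc
  nlinarith [mul_pos h (neg_pos.2 hc), mul_nonneg (sq_nonneg k) (add_nonneg (sq_nonneg a.1) (sq_nonneg a.2))]

lemma KHform_smul_right (k : ℝ) (x a b : ℝ × ℝ) (c : ℝ) :
    KHform k x a (c • b) = c * KHform k x a b := by
  simp [KHform]; ring

lemma KHform_smul_self (k : ℝ) (x a : ℝ × ℝ) (c : ℝ) :
    KHform k x (c • a) (c • a) = c ^ 2 * KHform k x a a := by
  simp [KHform]; ring

lemma KHform_sub_left (k : ℝ) (x a b c : ℝ × ℝ) :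
    KHform k x (a - b) c = KHform k x a c - KHform k x b c := by
  simp [KHform]; ring

lemma KHform_smul_left (k : ℝ) (x a b : ℝ × ℝ) (c : ℝ) :
    KHform k x (c • a) b = c * KHform k x a b := by
  simp [KHform]; ring

/-- `N(a) ≤ (1+θ) N(b) + (1+1/θ) N(a-b)` in weak form. -/
lemma KHform_quad {k : ℝ} (hk : 0 < k) (x a b : ℝ × ℝ) {θ : ℝ} (hθ : 0 < θ) :
    KHform k x a a ≤ (1 + θ) * KHform k x b b + (1 + θ⁻¹) * KHform k x (a - b) (a - b) := by
  have h := KHform_self_nonneg hk x (θ • b - (a - b))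
  have e : (1 + θ) * KHform k x b b + (1 + θ⁻¹) * KHform k x (a - b) (a - b) - KHform k x a a
      = θ⁻¹ * KHform k x (θ • b - (a - b)) (θ • b - (a - b)) := by
    have := hθ.ne'
    simp only [KHform, Prod.fst_sub, Prod.snd_sub, Prod.smul_fst, Prod.smul_snd, smul_eq_mul]
    field_simp
    ring
  have := mul_nonneg (inv_nonneg.2 hθ.le) h
  linarith

lemma fderiv_norm_sq_le (w : ℝ × ℝ → ℝ) (x : ℝ × ℝ) :
    ‖fderiv ℝ w x‖ ^ 2 ≤ 2 * ((grad w x).1 ^ 2 + (grad w x).2 ^ 2) := by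
  have h : ‖fderiv ℝ w x‖ ≤ |(grad w x).1| + |(grad w x).2| := by
    refine ContinuousLinearMap.opNorm_le_bound _ (by positivity) fun y => ?_
    have e : fderiv ℝ w x y = y.1 * (grad w x).1 + y.2 * (grad w x).2 := by
      conv_lhs => rw [show y = y.1 • ((1:ℝ), (0:ℝ)) + y.2 • ((0:ℝ), (1:ℝ)) by ext <;> simp]
      rw [map_add, map_smul, map_smul]; rfl
    rw [e, Real.norm_eq_abs]
    have h1 : |y.1| ≤ ‖y‖ := norm_fst_le y
    have h2 : |y.2| ≤ ‖y‖ := norm_snd_le y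
    calc _ ≤ |y.1 * (grad w x).1| + |y.2 * (grad w x).2| := abs_add_le _ _
      _ ≤ _ := by
        rw [abs_mul, abs_mul]
        nlinarith [abs_nonneg (grad w x).1, abs_nonneg (grad w x).2]
  have := norm_nonneg (fderiv ℝ w x)
  nlinarith [sq_abs (grad w x).1, sq_abs (grad w x).2, sq_nonneg (|(grad w x).1| - |(grad w x).2|)]

/-! ### Profiles -/

structure Prof (P P' : ℝ → ℝ) : Prop where
  hd : ∀ s, HasDerivAt P (P' s) s
  hc : Continuous P'
  h0 : ∀ s ≤ 0, P s = 0
  h0' : ∀ s ≤ 0, P' s = 0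
  hn : ∀ s, 0 ≤ P' s

lemma Prof.contDiff {P P' : ℝ → ℝ} (h : Prof P P') : ContDiff ℝ 1 P := by
  rw [contDiff_one_iff_deriv]
  refine ⟨fun s => (h.hd s).differentiableAt, ?_⟩
  rw [show deriv P = P' from funext fun s => (h.hd s).deriv]
  exact h.hc

lemma prof_pow {m : ℝ} (hm : 1 < m) :
    Prof (fun s => max s 0 ^ m) (fun s => m * max s 0 ^ (m - 1)) := by
  have c1 : Continuous (fun s : ℝ => max s 0 ^ m) :=
    (continuous_id.max continuous_const).rpow_const (fun _ => Or.inr (by linarith))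
  have c2 : Continuous (fun s : ℝ => m * max s 0 ^ (m - 1)) :=
    continuous_const.mul
      ((continuous_id.max continuous_const).rpow_const (fun _ => Or.inr (by linarith)))
  have z1 : ∀ s ≤ (0:ℝ), max s 0 ^ m = 0 := fun s hs => by
    rw [max_eq_right hs, Real.zero_rpow (by linarith)]
  have z2 : ∀ s ≤ (0:ℝ), m * max s 0 ^ (m - 1) = 0 := fun s hs => by
    rw [max_eq_right hs, Real.zero_rpow (by linarith), mul_zero]
  refine ⟨?_, c2, z1, z2, fun s => by positivity⟩
  refine hasDerivAt_of_hasDerivAt_of_ne' (x := 0) (fun y hy => ?_) c1.continuousAt c2.continuousAt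
  rcases lt_or_gt_of_ne hy with h | h
  · rw [z2 y h.le]
    refine (hasDerivAt_const y (0:ℝ)).congr_of_eventuallyEq ?_
    filter_upwards [Iio_mem_nhds h] with s hs using z1 s (le_of_lt hs)
  · rw [max_eq_left h.le]
    refine (Real.hasDerivAt_rpow_const (Or.inl h.ne')).congr_of_eventuallyEq ?_
    filter_upwards [Ioi_mem_nhds h] with s hs
    rw [max_eq_left (le_of_lt hs)]

lemma prof_sqrt {δ : ℝ} (hδ : 0 < δ) :
    Prof (fun s => √(max s 0 ^ 2 + δ ^ 2) - δ) (fun s => max s 0 / √(max s 0 ^ 2 + δ ^ 2)) := by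
  have hp : ∀ s : ℝ, 0 < max s 0 ^ 2 + δ ^ 2 := fun s => by positivity
  refine ⟨fun s => ?_, ?_, ?_, ?_, fun s => by positivity⟩
  · have h2 := (prof_pow one_lt_two).hd s
    have h3 : HasDerivAt (fun s : ℝ => max s 0 ^ 2) (2 * max s 0) s := by
      convert h2 using 1
      · funext s; rw [Real.rpow_two]
      · norm_num
    have h4 := ((h3.add_const (δ ^ 2)).sqrt (hp s).ne').sub_const δ
    rw [mul_div_mul_left _ _ two_ne_zero] at h4
    exact h4
  · refine (continuous_id.max continuous_const).div (by fun_prop) fun s => (Real.sqrt_pos.2 (hp s)).ne'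
  · intro s hs; simp [max_eq_right hs, Real.sqrt_sq hδ.le]
  · intro s hs; simp [max_eq_right hs]

lemma prof_sqrt_le_one {δ : ℝ} (hδ : 0 < δ) (s : ℝ) : max s 0 / √(max s 0 ^ 2 + δ ^ 2) ≤ 1 := by
  rw [div_le_one (Real.sqrt_pos.2 (by positivity))]
  exact Real.le_sqrt_of_sq_le (by nlinarith)

lemma prof_sqrt_ge {δ : ℝ} (_hδ : 0 < δ) (s : ℝ) : s - δ ≤ √(max s 0 ^ 2 + δ ^ 2) - δ := by
  have : max s 0 ≤ √(max s 0 ^ 2 + δ ^ 2) := Real.le_sqrt_of_sq_le (by nlinarith)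
  linarith [le_max_left s 0]

lemma prof_sqrt_nonneg {δ : ℝ} (hδ : 0 < δ) (s : ℝ) : 0 ≤ √(max s 0 ^ 2 + δ ^ 2) - δ := by
  have : δ ≤ √(max s 0 ^ 2 + δ ^ 2) := Real.le_sqrt_of_sq_le (by nlinarith [sq_nonneg (max s 0)])
  linarith

/-! ### Cauchy-Schwarz -/

lemma cs_integral {α : Type*} [MeasurableSpace α] {μ : Measure α} {a b c : α → ℝ}
    (ha : Integrable a μ) (hb : Integrable b μ) (hc : Integrable c μ)
    (ha0 : ∀ᵐ x ∂μ, 0 ≤ a x) (hb0 : ∀ᵐ x ∂μ, 0 ≤ b x)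
    (h : ∀ᵐ x ∂μ, c x ^ 2 ≤ a x * b x) :
    (∫ x, c x ∂μ) ^ 2 ≤ (∫ x, a x ∂μ) * ∫ x, b x ∂μ := by
  have key : ∀ t : ℝ, 0 ≤ (∫ x, a x ∂μ) * (t * t) + (2 * ∫ x, c x ∂μ) * t + ∫ x, b x ∂μ := by
    intro t
    have e : (∫ x, a x ∂μ) * (t * t) + (2 * ∫ x, c x ∂μ) * t + ∫ x, b x ∂μ
        = ∫ x, (a x * (t * t) + c x * (2 * t) + b x) ∂μ := by
      have hh : Integrable (fun x => a x * (t * t) + c x * (2 * t)) μ :=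
        (ha.mul_const _).add (hc.mul_const _)
      rw [integral_add hh hb,
        integral_add (ha.mul_const _) (hc.mul_const _), integral_mul_const, integral_mul_const]
      ring
    rw [e]
    apply integral_nonneg_of_ae
    filter_upwards [ha0, hb0, h] with x h1 h2 h3
    show 0 ≤ _
    rcases h1.eq_or_lt with h4 | h4
    · have : c x = 0 := by
        rw [← h4, zero_mul] at h3
        exact pow_eq_zero_iff (two_ne_zero) |>.1 (le_antisymm h3 (sq_nonneg _))
      rw [← h4, this]; simpa using h2
    · have : 0 ≤ a x * (a x * (t * t) + c x * (2 * t) + b x) := by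
        nlinarith [sq_nonneg (a x * t + c x)]
      exact nonneg_of_mul_nonneg_right this h4
  have := discrim_le_zero key
  rw [discrim] at this
  nlinarith

/-! ### Gluing and integration by parts -/

lemma glue_contDiff {Ω K : Set (ℝ × ℝ)} (hΩo : IsOpen Ω) (hK : IsClosed K) (hKΩ : K ⊆ Ω)
    {F : ℝ × ℝ → ℝ} (hF : ContDiffOn ℝ 1 F Ω) (h0 : ∀ x ∉ K, F x = 0) : ContDiff ℝ 1 F := by
  rw [contDiff_iff_contDiffAt]
  intro x
  by_cases hx : x ∈ Ω
  · exact hF.contDiffAt (hΩo.mem_nhds hx)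
  · have hxK : x ∈ Kᶜ := fun h => hx (hKΩ h)
    refine (contDiffAt_const (c := (0:ℝ))).congr_of_eventuallyEq ?_
    filter_upwards [hK.isOpen_compl.mem_nhds hxK] with y hy using h0 y hy

lemma fderiv_zero_off {K : Set (ℝ × ℝ)} (hK : IsClosed K) {F : ℝ × ℝ → ℝ}
    (h0 : ∀ x ∉ K, F x = 0) {x : ℝ × ℝ} (hx : x ∉ K) : fderiv ℝ F x = 0 := by
  have : F =ᶠ[𝓝 x] fun _ => 0 := by
    filter_upwards [hK.isOpen_compl.mem_nhds hx] with y hy using h0 y hy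
  rw [this.fderiv_eq]; simp

lemma integrableOn_of_core {Ω K : Set (ℝ × ℝ)} (hΩo : IsOpen Ω) (hK : IsCompact K) (hKΩ : K ⊆ Ω)
    {h : ℝ × ℝ → ℝ} (hh : ContinuousOn h Ω) (h0 : ∀ x ∈ Ω, x ∉ K → h x = 0) :
    IntegrableOn h Ω := by
  have h1 : IntegrableOn h K := (hh.mono hKΩ).integrableOn_compact hK
  exact h1.of_forall_sdiff_eq_zero hΩo.measurableSet (fun x hx => h0 x hx.1 hx.2)

lemma contDiffOn_KHvec {k : ℝ} (hk : 0 < k) {Ω : Set (ℝ × ℝ)} (hΩo : IsOpen Ω)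
    {u : ℝ × ℝ → ℝ} (hu : ContDiffOn ℝ 2 u Ω) :
    ContDiffOn ℝ 1 (fun y => (KHvec k y (grad u y)).1) Ω ∧
    ContDiffOn ℝ 1 (fun y => (KHvec k y (grad u y)).2) Ω := by
  have hf : ContDiffOn ℝ 1 (fderiv ℝ u) Ω := hu.fderiv_of_isOpen hΩo (by norm_num)
  have g1 : ContDiffOn ℝ 1 (fun y => (grad u y).1) Ω := hf.clm_apply contDiffOn_const
  have g2 : ContDiffOn ℝ 1 (fun y => (grad u y).2) Ω := hf.clm_apply contDiffOn_const
  have d : ContDiffOn ℝ 1 (fun y : ℝ × ℝ => (k ^ 2 + y.1 ^ 2 + y.2 ^ 2)⁻¹) Ω := by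
    have d0 : ContDiff ℝ 1 (fun y : ℝ × ℝ => (k ^ 2 + y.1 ^ 2 + y.2 ^ 2)) := by fun_prop
    exact (d0.inv fun y => (KH_den_pos hk y).ne').contDiffOn
  have a1 : ContDiffOn ℝ 1 (fun y : ℝ × ℝ => (k ^ 2 + y.2 ^ 2)) Ω := by fun_prop
  have a2 : ContDiffOn ℝ 1 (fun y : ℝ × ℝ => y.1 * y.2) Ω := by fun_prop
  have a3 : ContDiffOn ℝ 1 (fun y : ℝ × ℝ => (k ^ 2 + y.1 ^ 2)) Ω := by fun_prop
  exact ⟨d.mul ((a1.mul g1).sub (a2.mul g2)), d.mul ((a2.neg.mul g1).add (a3.mul g2))⟩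

lemma continuousOn_grad {Ω : Set (ℝ × ℝ)} (hΩo : IsOpen Ω) {u : ℝ × ℝ → ℝ}
    (hu : ContDiffOn ℝ 1 u Ω) : ContinuousOn (grad u) Ω := by
  have hf : ContinuousOn (fderiv ℝ u) Ω := hu.continuousOn_fderiv_of_isOpen hΩo le_rfl
  exact (hf.clm_apply continuousOn_const).prodMk (hf.clm_apply continuousOn_const)

lemma continuousOn_KHform {k : ℝ} (hk : 0 < k) {Ω : Set (ℝ × ℝ)} {a b : ℝ × ℝ → ℝ × ℝ}
    (ha : ContinuousOn a Ω) (hb : ContinuousOn b Ω) :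
    ContinuousOn (fun x => KHform k x (a x) (b x)) Ω := by
  have d : Continuous (fun y : ℝ × ℝ => (k ^ 2 + y.1 ^ 2 + y.2 ^ 2)⁻¹) :=
    Continuous.inv₀ (by fun_prop) fun y => (KH_den_pos hk y).ne'
  have a1 := continuous_fst.comp_continuousOn ha
  have a2 := continuous_snd.comp_continuousOn ha
  have b1 := continuous_fst.comp_continuousOn hb
  have b2 := continuous_snd.comp_continuousOn hb
  simp only [Function.comp_def] at a1 a2 b1 b2
  unfold KHform
  refine d.continuousOn.mul ?_
  fun_prop

lemma integral_fderiv_zero {X : ℝ × ℝ → ℝ} (hX : ContDiff ℝ 1 X) (hs : HasCompactSupport X)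
    (e : ℝ × ℝ) : ∫ x, fderiv ℝ X x e = 0 := by
  have hc : Continuous (fun x => fderiv ℝ X x e) := by
    exact (hX.continuous_fderiv one_ne_zero).clm_apply continuous_const
  have hcs : HasCompactSupport (fun x => fderiv ℝ X x e) := hs.fderiv_apply ℝ e
  have := integral_mul_fderiv_eq_neg_fderiv_mul_of_integrable (μ := (volume : Measure (ℝ × ℝ)))
    (f := fun _ => (1:ℝ)) (g := X) (v := e) (by simp)
    (by simpa using hc.integrable_of_hasCompactSupport hcs)
    (by simpa using hX.continuous.integrable_of_hasCompactSupport hs)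
    (fun x _ => by fun_prop) (fun x _ => hX.differentiable one_ne_zero x)
  simpa using this

lemma ibp {k : ℝ} (hk : 0 < k) {Ω K : Set (ℝ × ℝ)} (hΩo : IsOpen Ω) (hK : IsCompact K)
    (hKΩ : K ⊆ Ω) {F : ℝ × ℝ → ℝ} (hF : ContDiff ℝ 1 F) (h0 : ∀ x ∉ K, F x = 0)
    {u : ℝ × ℝ → ℝ} (hu : ContDiffOn ℝ 2 u Ω) :
    IntegrableOn (fun x => KHform k x (grad u x) (grad F x)) Ω ∧
    ∫ x in Ω, KHform k x (grad u x) (grad F x) = ∫ x in Ω, F x * LH k u x := by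
  obtain ⟨hV1, hV2⟩ := contDiffOn_KHvec hk hΩo hu
  set V1 := fun y => (KHvec k y (grad u y)).1 with hV1d
  set V2 := fun y => (KHvec k y (grad u y)).2 with hV2d
  have hgF : ∀ x ∉ K, grad F x = 0 := fun x hx => by
    simp [grad, fderiv_zero_off hK.isClosed h0 hx]
  have i1 : IntegrableOn (fun x => KHform k x (grad u x) (grad F x)) Ω := by
    refine integrableOn_of_core hΩo hK hKΩ ?_ ?_
    · exact continuousOn_KHform hk (continuousOn_grad hΩo (hu.of_le (by norm_num)))
        (continuousOn_grad hΩo hF.contDiffOn)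
    · intro x _ hx
      rw [hgF x hx]; simp [KHform]
  have cLH : ContinuousOn (LH k u) Ω := by
    have c1 := (hV1.continuousOn_fderiv_of_isOpen hΩo le_rfl).clm_apply
      (continuousOn_const (c := ((1:ℝ), (0:ℝ))))
    have c2 := (hV2.continuousOn_fderiv_of_isOpen hΩo le_rfl).clm_apply
      (continuousOn_const (c := ((0:ℝ), (1:ℝ))))
    exact (c1.add c2).neg
  have i2 : IntegrableOn (fun x => F x * LH k u x) Ω := by
    refine integrableOn_of_core hΩo hK hKΩ (hF.continuous.continuousOn.mul cLH) ?_
    intro x _ hx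
    rw [h0 x hx, zero_mul]
  refine ⟨i1, ?_⟩
  have main : ∀ V : ℝ × ℝ → ℝ, ContDiffOn ℝ 1 V Ω → ∀ e : ℝ × ℝ,
      IntegrableOn (fun x => F x * fderiv ℝ V x e + V x * fderiv ℝ F x e) Ω ∧
      ∫ x in Ω, (F x * fderiv ℝ V x e + V x * fderiv ℝ F x e) = 0 := by
    intro V hV e
    set X := Ω.indicator (fun x => F x * V x) with hX
    have hX0 : ∀ x ∉ K, X x = 0 := fun x hx => by
      by_cases hxΩ : x ∈ Ω
      · rw [hX, indicator_of_mem hxΩ, h0 x hx, zero_mul]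
      · rw [hX, indicator_of_notMem hxΩ]
    have hXc : ContDiff ℝ 1 X := by
      refine glue_contDiff hΩo hK.isClosed hKΩ ?_ hX0
      exact (hF.contDiffOn.mul hV).congr fun x hx => indicator_of_mem hx _
    have hXs : HasCompactSupport X := HasCompactSupport.intro hK hX0
    have hXd : ∀ x ∈ Ω, fderiv ℝ X x e = F x * fderiv ℝ V x e + V x * fderiv ℝ F x e := by
      intro x hx
      have : X =ᶠ[𝓝 x] fun x => F x * V x := by
        filter_upwards [hΩo.mem_nhds hx] with y hy using indicator_of_mem hy _
      rw [this.fderiv_eq, fderiv_fun_mul (hF.differentiable one_ne_zero x)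
        ((hV.contDiffAt (hΩo.mem_nhds hx)).differentiableAt one_ne_zero)]
      simp
    have hint := integral_fderiv_zero hXc hXs e
    have hc : Continuous (fun x => fderiv ℝ X x e) :=
      (hXc.continuous_fderiv one_ne_zero).clm_apply continuous_const
    have hi : Integrable (fun x => fderiv ℝ X x e) :=
      hc.integrable_of_hasCompactSupport (hXs.fderiv_apply ℝ e)
    constructor
    · exact hi.integrableOn.congr_fun hXd hΩo.measurableSet
    · rw [← setIntegral_congr_fun hΩo.measurableSet hXd,
        setIntegral_eq_integral_of_forall_compl_eq_zero, hint]
      intro x hx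
      rw [fderiv_zero_off hK.isClosed hX0 (fun h => hx (hKΩ h))]; rfl
  obtain ⟨j1, e1⟩ := main V1 hV1 (1, 0)
  obtain ⟨j2, e2⟩ := main V2 hV2 (0, 1)
  have e3 := integral_add j1 j2
  rw [e1, e2, add_zero] at e3
  rw [← sub_eq_zero, ← integral_sub i1 i2, ← e3]
  refine setIntegral_congr_fun hΩo.measurableSet fun x _ => ?_
  simp only [KHform_eq_vec, LH, div2]
  simp only [hV1d, hV2d, grad]
  ring

/-! ### Sobolev -/

lemma gns : ∃ C : ℝ, 0 ≤ C ∧ ∀ F : ℝ × ℝ → ℝ, ContDiff ℝ 1 F → HasCompactSupport F →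
    ∫ x, F x ^ 2 ≤ C * (∫ x, ‖fderiv ℝ F x‖) ^ 2 := by
  refine ⟨(lintegralPowLePowLIntegralFDerivConst (volume : Measure (ℝ × ℝ)) 2 : ℝ),
    NNReal.coe_nonneg _, fun F hF hs => ?_⟩
  have hpq : Real.HolderConjugate (Module.finrank ℝ (ℝ × ℝ)) 2 := by
    simp; norm_num [Real.holderConjugate_iff]
  have h := lintegral_pow_le_pow_lintegral_fderiv (volume : Measure (ℝ × ℝ)) hF hs hpq
  have c1 : Continuous (fun x => F x ^ 2) := hF.continuous.pow 2
  have i1 : Integrable (fun x => F x ^ 2) := by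
    refine c1.integrable_of_hasCompactSupport ?_
    exact hs.comp_left (g := fun t : ℝ => t ^ 2) (by norm_num)
  have i2 : Integrable (fun x => ‖fderiv ℝ F x‖) :=
    ((hF.continuous_fderiv one_ne_zero).integrable_of_hasCompactSupport (hs.fderiv ℝ)).norm
  have a1 : ∫⁻ x, ‖F x‖ₑ ^ (2:ℝ) = ENNReal.ofReal (∫ x, F x ^ 2) := by
    rw [ofReal_integral_eq_lintegral_ofReal i1 (Eventually.of_forall fun x => sq_nonneg _)]
    refine lintegral_congr fun x => ?_
    rw [← ofReal_norm, ENNReal.ofReal_rpow_of_nonneg (norm_nonneg _) (by norm_num)]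
    simp
  have a2 : ∫⁻ x, ‖fderiv ℝ F x‖ₑ = ENNReal.ofReal (∫ x, ‖fderiv ℝ F x‖) := by
    rw [ofReal_integral_eq_lintegral_ofReal i2 (Eventually.of_forall fun x => norm_nonneg _)]
    refine lintegral_congr fun x => ?_
    rw [← ofReal_norm]
  have p2 : 0 ≤ ∫ x, ‖fderiv ℝ F x‖ := integral_nonneg fun x => norm_nonneg _
  rw [a1, a2, ENNReal.ofReal_rpow_of_nonneg p2 (by norm_num), ← ENNReal.ofReal_coe_nnreal,
    ← ENNReal.ofReal_mul (NNReal.coe_nonneg _), ENNReal.ofReal_le_ofReal_iff (by positivity)] at h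
  simpa using h

/-! ### Truncations -/

structure Adm (Ω : Set (ℝ × ℝ)) (w : ℝ × ℝ → ℝ) : Prop where
  cont : ContinuousOn w (closure Ω)
  diff : ContDiffOn ℝ 1 w Ω
  neg : ∀ x ∈ frontier Ω, w x < 0

def coreK (Ω : Set (ℝ × ℝ)) (w : ℝ × ℝ → ℝ) : Set (ℝ × ℝ) := closure Ω ∩ w ⁻¹' (Ici 0)

def extP (Ω : Set (ℝ × ℝ)) (P : ℝ → ℝ) (w : ℝ × ℝ → ℝ) : ℝ × ℝ → ℝ :=
  Ω.indicator (fun x => P (w x))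

section
variable {Ω : Set (ℝ × ℝ)} {w : ℝ × ℝ → ℝ} {P P' : ℝ → ℝ}

lemma Adm.isCompact_core (hΩb : Bornology.IsBounded Ω) (h : Adm Ω w) : IsCompact (coreK Ω w) :=
  hΩb.isCompact_closure.of_isClosed_subset
    (h.cont.preimage_isClosed_of_isClosed isClosed_closure isClosed_Ici) inter_subset_left

lemma Adm.core_subset (hΩo : IsOpen Ω) (h : Adm Ω w) : coreK Ω w ⊆ Ω := by
  rintro x ⟨hx, hx2⟩
  by_contra hc
  have : x ∈ frontier Ω := by
    rw [hΩo.frontier_eq]; exact ⟨hx, hc⟩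
  exact absurd (h.neg x this) (not_lt.2 hx2)

lemma neg_of_notMem_core {x : ℝ × ℝ} (hx : x ∈ Ω) (hK : x ∉ coreK Ω w) : w x ≤ 0 := by
  by_contra hc
  exact hK ⟨subset_closure hx, le_of_lt (not_le.1 hc)⟩

lemma extP_zero (hP : Prof P P') : ∀ x ∉ coreK Ω w, extP Ω P w x = 0 := by
  intro x hx
  by_cases hxΩ : x ∈ Ω
  · rw [extP, indicator_of_mem hxΩ]
    exact hP.h0 _ (neg_of_notMem_core hxΩ hx)
  · rw [extP, indicator_of_notMem hxΩ]

lemma extP_contDiff (hΩo : IsOpen Ω) (hΩb : Bornology.IsBounded Ω) (h : Adm Ω w)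
    (hP : Prof P P') : ContDiff ℝ 1 (extP Ω P w) := by
  refine glue_contDiff hΩo (h.isCompact_core hΩb).isClosed (h.core_subset hΩo) ?_ (extP_zero hP)
  exact (hP.contDiff.comp_contDiffOn h.diff).congr fun x hx => indicator_of_mem hx _

lemma extP_compact (hΩb : Bornology.IsBounded Ω) (h : Adm Ω w)
    (hP : Prof P P') : HasCompactSupport (extP Ω P w) :=
  HasCompactSupport.intro (h.isCompact_core hΩb) (extP_zero hP)

lemma Adm.differentiableAt (hΩo : IsOpen Ω) (h : Adm Ω w) {x : ℝ × ℝ} (hx : x ∈ Ω) :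
    DifferentiableAt ℝ w x :=
  (h.diff.contDiffAt (hΩo.mem_nhds hx)).differentiableAt one_ne_zero

lemma extP_fderiv (hΩo : IsOpen Ω) (h : Adm Ω w) (hP : Prof P P') {x : ℝ × ℝ} (hx : x ∈ Ω) :
    fderiv ℝ (extP Ω P w) x = P' (w x) • fderiv ℝ w x := by
  have : extP Ω P w =ᶠ[𝓝 x] fun x => P (w x) := by
    filter_upwards [hΩo.mem_nhds hx] with y hy using indicator_of_mem hy _
  rw [this.fderiv_eq]
  exact ((hP.hd (w x)).comp_hasFDerivAt x (h.differentiableAt hΩo hx).hasFDerivAt).fderiv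

lemma extP_grad (hΩo : IsOpen Ω) (h : Adm Ω w) (hP : Prof P P') {x : ℝ × ℝ} (hx : x ∈ Ω) :
    grad (extP Ω P w) x = P' (w x) • grad w x := by
  simp [grad, extP_fderiv hΩo h hP hx]

/-- integrability of a function killed outside the core. -/
lemma Adm.integrableOn (hΩo : IsOpen Ω) (hΩb : Bornology.IsBounded Ω) (h : Adm Ω w)
    {g : ℝ × ℝ → ℝ} (hg : ContinuousOn g Ω) (h0 : ∀ x ∈ Ω, w x ≤ 0 → g x = 0) :
    IntegrableOn g Ω :=
  integrableOn_of_core hΩo (h.isCompact_core hΩb) (h.core_subset hΩo) hg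
    fun x hx hK => h0 x hx (neg_of_notMem_core hx hK)

lemma ellip {k : ℝ} (hk : 0 < k) (hΩb : Bornology.IsBounded Ω) :
    ∃ C : ℝ, 0 ≤ C ∧ ∀ x ∈ Ω, ∀ w : ℝ × ℝ → ℝ,
      ‖fderiv ℝ w x‖ ≤ C * √(KHform k x (grad w x) (grad w x)) := by
  obtain ⟨R, hR⟩ := hΩb.exists_norm_le
  refine ⟨√(2 * (k ^ 2 + R ^ 2 + R ^ 2) / k ^ 2), by positivity, fun x hx w => ?_⟩
  rw [← Real.sqrt_mul (by positivity)]
  refine Real.le_sqrt_of_sq_le ?_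
  refine (fderiv_norm_sq_le w x).trans ?_
  have h1 := KHform_self_ge hk x (grad w x)
  have h2 := KHform_self_nonneg hk x (grad w x)
  have a1 : x.1 ^ 2 ≤ R ^ 2 := by
    rw [← sq_abs x.1]; exact pow_le_pow_left₀ (abs_nonneg _) ((norm_fst_le x).trans (hR x hx)) 2
  have a2 : x.2 ^ 2 ≤ R ^ 2 := by
    rw [← sq_abs x.2]; exact pow_le_pow_left₀ (abs_nonneg _) ((norm_snd_le x).trans (hR x hx)) 2
  rw [div_mul_eq_mul_div, le_div_iff₀ (by positivity)]
  nlinarith [mul_nonneg (sub_nonneg.2 a1) h2, mul_nonneg (sub_nonneg.2 a2) h2]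

lemma continuousOn_KHself {k : ℝ} (hk : 0 < k) (hΩo : IsOpen Ω) (h : ContDiffOn ℝ 1 w Ω) :
    ContinuousOn (fun x => KHform k x (grad w x) (grad w x)) Ω :=
  continuousOn_KHform hk (continuousOn_grad hΩo h) (continuousOn_grad hΩo h)

lemma sobolev {k : ℝ} (hk : 0 < k) (hΩo : IsOpen Ω) (hΩb : Bornology.IsBounded Ω) :
    ∃ C : ℝ, 0 < C ∧ ∀ (P P' : ℝ → ℝ) (w : ℝ × ℝ → ℝ), Prof P P' → Adm Ω w →
      ∫ x in Ω, P (w x) ^ 2 ≤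
        C * (∫ x in Ω, P' (w x) * √(KHform k x (grad w x) (grad w x))) ^ 2 := by
  obtain ⟨C0, hC0, hgns⟩ := gns
  obtain ⟨C1, hC1, hell⟩ := ellip hk hΩb
  refine ⟨C0 * C1 ^ 2 + 1, by positivity, fun P P' w hP h => ?_⟩
  have h1 := hgns _ (extP_contDiff hΩo hΩb h hP) (extP_compact hΩb h hP)
  have e1 : ∫ x, extP Ω P w x ^ 2 = ∫ x in Ω, P (w x) ^ 2 := by
    rw [← setIntegral_eq_integral_of_forall_compl_eq_zero (s := Ω)]
    · refine setIntegral_congr_fun hΩo.measurableSet fun x hx => ?_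
      simp [extP, hx]
    · intro x hx; simp [extP, hx]
  have z2 : ∀ x, x ∉ Ω → ‖fderiv ℝ (extP Ω P w) x‖ = 0 := by
    intro x hx
    rw [fderiv_zero_off (h.isCompact_core hΩb).isClosed (extP_zero hP)
      (fun hh => hx (h.core_subset hΩo hh)), norm_zero]
  have cw : ContinuousOn (fun x => P' (w x)) Ω := hP.hc.comp_continuousOn (h.cont.mono subset_closure)
  have i3 : IntegrableOn (fun x => P' (w x) * √(KHform k x (grad w x) (grad w x))) Ω := by
    refine h.integrableOn hΩo hΩb (cw.mul (continuousOn_KHself hk hΩo h.diff).sqrt) ?_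
    intro x _ hw; rw [hP.h0' _ hw, zero_mul]
  have i2 : Integrable (fun x => ‖fderiv ℝ (extP Ω P w) x‖) :=
    (((extP_contDiff hΩo hΩb h hP).continuous_fderiv one_ne_zero).integrable_of_hasCompactSupport
      ((extP_compact hΩb h hP).fderiv ℝ)).norm
  have e2 : ∫ x, ‖fderiv ℝ (extP Ω P w) x‖ ≤
      C1 * ∫ x in Ω, P' (w x) * √(KHform k x (grad w x) (grad w x)) := by
    rw [← setIntegral_eq_integral_of_forall_compl_eq_zero (s := Ω) z2, ← integral_const_mul]
    refine setIntegral_mono_on i2.integrableOn (i3.const_mul C1) hΩo.measurableSet fun x hx => ?_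
    rw [extP_fderiv hΩo h hP hx, norm_smul, Real.norm_of_nonneg (hP.hn _)]
    have := mul_le_mul_of_nonneg_left (hell x hx w) (hP.hn (w x))
    linarith
  rw [e1] at h1
  have p2 : 0 ≤ ∫ x, ‖fderiv ℝ (extP Ω P w) x‖ := integral_nonneg fun x => norm_nonneg _
  have := mul_le_mul_of_nonneg_left (pow_le_pow_left₀ p2 e2 2) hC0
  rw [mul_pow] at this
  nlinarith [sq_nonneg (∫ x in Ω, P' (w x) * √(KHform k x (grad w x) (grad w x)))]

/-- First form. -/
lemma sobolev1 {k : ℝ} (hk : 0 < k) (hΩo : IsOpen Ω) (hΩb : Bornology.IsBounded Ω) :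
    ∃ C : ℝ, 0 < C ∧ ∀ (P P' : ℝ → ℝ) (w : ℝ × ℝ → ℝ), Prof P P' → Adm Ω w →
      ∫ x in Ω, P (w x) ^ 2 ≤
        C * ((∫ x in Ω, P' (w x)) * ∫ x in Ω, P' (w x) * KHform k x (grad w x) (grad w x)) := by
  obtain ⟨C, hC, H⟩ := sobolev hk hΩo hΩb
  refine ⟨C, hC, fun P P' w hP h => (H P P' w hP h).trans ?_⟩
  refine mul_le_mul_of_nonneg_left ?_ hC.le
  have cw : ContinuousOn (fun x => P' (w x)) Ω := hP.hc.comp_continuousOn (h.cont.mono subset_closure)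
  have ck := continuousOn_KHself hk hΩo h.diff
  refine cs_integral (h.integrableOn hΩo hΩb cw fun x _ hw => hP.h0' _ hw)
    (h.integrableOn hΩo hΩb (cw.mul ck) fun x _ hw => by rw [hP.h0' _ hw, zero_mul])
    (h.integrableOn hΩo hΩb (cw.mul ck.sqrt) fun x _ hw => by rw [hP.h0' _ hw, zero_mul])
    (Eventually.of_forall fun x => hP.hn _)
    (Eventually.of_forall fun x => mul_nonneg (hP.hn _) (KHform_self_nonneg hk _ _))
    (Eventually.of_forall fun x => ?_)
  rw [mul_pow, Real.sq_sqrt (KHform_self_nonneg hk _ _)]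
  exact le_of_eq (by ring)

/-- Second form. -/
lemma sobolev2 {k : ℝ} (hk : 0 < k) (hΩo : IsOpen Ω) (hΩb : Bornology.IsBounded Ω) :
    ∃ C : ℝ, 0 < C ∧ ∀ (P P' : ℝ → ℝ) (w : ℝ × ℝ → ℝ), Prof P P' → Adm Ω w →
      IntegrableOn (fun x => KHform k x (grad w x) (grad w x)) Ω →
      ∫ x in Ω, P (w x) ^ 2 ≤
        C * ((∫ x in Ω, P' (w x) ^ 2) * ∫ x in Ω, KHform k x (grad w x) (grad w x)) := by
  obtain ⟨C, hC, H⟩ := sobolev hk hΩo hΩb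
  refine ⟨C, hC, fun P P' w hP h hi => (H P P' w hP h).trans ?_⟩
  refine mul_le_mul_of_nonneg_left ?_ hC.le
  have cw : ContinuousOn (fun x => P' (w x)) Ω := hP.hc.comp_continuousOn (h.cont.mono subset_closure)
  have ck := continuousOn_KHself hk hΩo h.diff
  refine cs_integral (h.integrableOn hΩo hΩb (cw.pow 2) fun x _ hw => by
      rw [hP.h0' _ hw]; norm_num)
    hi
    (h.integrableOn hΩo hΩb (cw.mul ck.sqrt) fun x _ hw => by rw [hP.h0' _ hw, zero_mul])
    (Eventually.of_forall fun x => sq_nonneg _)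
    (Eventually.of_forall fun x => (KHform_self_nonneg hk _ _))
    (Eventually.of_forall fun x => ?_)
  rw [mul_pow, Real.sq_sqrt (KHform_self_nonneg hk _ _)]

/-- Testing with `P(w)`. -/
lemma test_prof {k : ℝ} (hk : 0 < k) (hΩo : IsOpen Ω) (hΩb : Bornology.IsBounded Ω)
    (hP : Prof P P') (h : Adm Ω w) {u : ℝ × ℝ → ℝ} (hu : ContDiffOn ℝ 2 u Ω) :
    IntegrableOn (fun x => P' (w x) * KHform k x (grad u x) (grad w x)) Ω ∧
    ∫ x in Ω, P' (w x) * KHform k x (grad u x) (grad w x) = ∫ x in Ω, P (w x) * LH k u x := by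
  obtain ⟨i, e⟩ := ibp hk hΩo (h.isCompact_core hΩb) (h.core_subset hΩo)
    (extP_contDiff hΩo hΩb h hP) (extP_zero hP) hu
  have c1 : EqOn (fun x => KHform k x (grad u x) (grad (extP Ω P w) x))
      (fun x => P' (w x) * KHform k x (grad u x) (grad w x)) Ω := fun x hx => by
    simp only [extP_grad hΩo h hP hx, KHform_smul_right]
  have c2 : EqOn (fun x => extP Ω P w x * LH k u x) (fun x => P (w x) * LH k u x) Ω := fun x hx => by
    simp [extP, hx]
  exact ⟨i.congr_fun c1 hΩo.measurableSet, by
    rw [← setIntegral_congr_fun hΩo.measurableSet c1, e,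
      setIntegral_congr_fun hΩo.measurableSet c2]⟩

end

/-! ### Consequences of the equation -/

section
variable {k p ε : ℝ} {Ω : Set (ℝ × ℝ)} {q u : ℝ × ℝ → ℝ}

lemma int_sq_pos (hΩo : IsOpen Ω) (hΩb : Bornology.IsBounded Ω) {w : ℝ × ℝ → ℝ} {P P' : ℝ → ℝ}
    (h : Adm Ω w) (hP : Prof P P') {x : ℝ × ℝ} (hx : x ∈ Ω) (hne : P (w x) ≠ 0) :
    0 < ∫ x in Ω, P (w x) ^ 2 := by
  have e1 : ∫ x, extP Ω P w x ^ 2 = ∫ x in Ω, P (w x) ^ 2 := by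
    rw [← setIntegral_eq_integral_of_forall_compl_eq_zero (s := Ω)]
    · refine setIntegral_congr_fun hΩo.measurableSet fun x hx => ?_
      simp [extP, hx]
    · intro x hx; simp [extP, hx]
  rw [← e1]
  refine Continuous.integral_pos_of_hasCompactSupport_nonneg_nonzero (x := x)
    ((extP_contDiff hΩo hΩb h hP).continuous.pow 2) ?_ (fun x => sq_nonneg _) ?_
  · exact (extP_compact hΩb h hP).comp_left (g := fun t : ℝ => t ^ 2) (by norm_num)
  · simpa [extP, hx] using hne

lemma grad_sub_const (u : ℝ × ℝ → ℝ) (c : ℝ) : grad (fun x => u x - c) = grad u := by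
  funext x
  have h : fderiv ℝ (fun x => u x - c) x = fderiv ℝ u x := fderiv_sub_const c
  simp only [grad, h]

lemma harm_nonpos (hk : 0 < k) (hΩo : IsOpen Ω) (hΩb : Bornology.IsBounded Ω)
    (hc : ContinuousOn u (closure Ω)) (hu : ContDiffOn ℝ 2 u Ω)
    (h0 : ∀ x ∈ frontier Ω, u x = 0) (hL : ∀ x ∈ Ω, LH k u x = 0) : ∀ x ∈ Ω, u x ≤ 0 := by
  intro x hx
  refine le_of_forall_pos_le_add fun δ hδ => ?_
  rw [zero_add]
  by_contra hcon
  push Not at hcon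
  have hA : Adm Ω (fun x => u x - δ) :=
    ⟨hc.sub continuousOn_const, (hu.of_le (by norm_num)).sub contDiffOn_const,
      fun x hx => by rw [h0 x hx]; linarith⟩
  have hP := prof_pow (one_lt_two)
  obtain ⟨C, hC, H⟩ := sobolev1 hk hΩo hΩb
  have h1 := H _ _ _ hP hA
  have h2 := (test_prof hk hΩo hΩb hP hA hu).2
  have h3 : ∫ x in Ω, max (u x - δ) 0 ^ (2:ℝ) * LH k u x = 0 := by
    rw [setIntegral_congr_fun hΩo.measurableSet (g := fun _ => (0:ℝ))]
    · simp
    · intro x hx; simp [hL x hx]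
  rw [grad_sub_const] at h1 h2
  rw [h3] at h2
  rw [h2, mul_zero, mul_zero] at h1
  have h4 := int_sq_pos hΩo hΩb hA hP hx (by
    have : 0 < max (u x - δ) 0 := lt_max_of_lt_left (by linarith)
    positivity)
  linarith

lemma LH_neg (u : ℝ × ℝ → ℝ) (x : ℝ × ℝ) : LH k (fun y => - u y) x = - LH k u x := by
  have e : grad (fun y => - u y) = fun y => - grad u y := by
    funext y; simp [grad]
  have e1 : (fun y => (KHvec k y (grad (fun y => - u y) y)).1) = fun y => -(KHvec k y (grad u y)).1 := by
    rw [e]; funext y; simp [KHvec]; ring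
  have e2 : (fun y => (KHvec k y (grad (fun y => - u y) y)).2) = fun y => -(KHvec k y (grad u y)).2 := by
    rw [e]; funext y; simp [KHvec]; ring
  simp only [LH, div2]
  rw [e1, e2]
  simp
  ring

lemma harm_zero (hk : 0 < k) (hΩo : IsOpen Ω) (hΩb : Bornology.IsBounded Ω)
    (hc : ContinuousOn u (closure Ω)) (hu : ContDiffOn ℝ 2 u Ω)
    (h0 : ∀ x ∈ frontier Ω, u x = 0) (hL : ∀ x ∈ Ω, LH k u x = 0) : ∀ x ∈ Ω, u x = 0 := by
  intro x hx
  refine le_antisymm (harm_nonpos hk hΩo hΩb hc hu h0 hL x hx) ?_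
  have := harm_nonpos (u := fun y => - u y) hk hΩo hΩb hc.neg hu.neg (fun x hx => by simp [h0 x hx])
    (fun x hx => by rw [LH_neg, hL x hx, neg_zero]) x hx
  simpa using this

lemma adm_v {L : ℝ} (hL : 0 < L) (hqc : ContinuousOn q (closure Ω)) (hq1 : ContDiffOn ℝ 2 q Ω)
    (hq3 : ∀ x ∈ closure Ω, 0 < q x) (hc : ContinuousOn u (closure Ω)) (hu : ContDiffOn ℝ 1 u Ω)
    (h0 : ∀ x ∈ frontier Ω, u x = 0) : Adm Ω (fun x => u x - q x * L) :=
  ⟨hc.sub (hqc.mul continuousOn_const), hu.sub ((hq1.of_le (by norm_num)).mul contDiffOn_const),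
    fun x hx => by
      rw [h0 x hx]
      have := mul_pos (hq3 x (frontier_subset_closure hx)) hL
      linarith⟩

/-- A mountain pass type solution with empty core is trivial, hence has zero energy. -/
lemma energy_zero_of_empty (hk : 0 < k) (hp : 1 < p) (hΩo : IsOpen Ω) (hΩb : Bornology.IsBounded Ω)
    (hs : IsSolution k p ε q Ω u) (hA : ∀ x ∈ Ω, u x ≤ q x * Real.log (1 / ε)) :
    Ieps k p ε q Ω u = 0 := by
  obtain ⟨hc, hu, h0, hL⟩ := hs
  have hz := harm_zero hk hΩo hΩb hc hu h0 (fun x hx => by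
    rw [hL x hx, pPart, max_eq_right (by linarith [hA x hx]), Real.zero_rpow (by linarith), mul_zero])
  have e1 : ∫ x in Ω, KHform k x (grad u x) (grad u x) = 0 := by
    rw [setIntegral_congr_fun hΩo.measurableSet (g := fun _ => (0:ℝ))]
    · simp
    · intro x hx
      have : u =ᶠ[𝓝 x] fun _ => 0 := by
        filter_upwards [hΩo.mem_nhds hx] with y hy using hz y hy
      simp [grad, this.fderiv_eq, KHform]
  have e2 : ∫ x in Ω, pPart (u x - q x * Real.log (1 / ε)) ^ (p + 1) = 0 := by
    rw [setIntegral_congr_fun hΩo.measurableSet (g := fun _ => (0:ℝ))]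
    · simp
    · intro x hx
      simp only
      rw [pPart, max_eq_right (by linarith [hA x hx]), Real.zero_rpow (by linarith)]
  rw [Ieps, e1, e2]; simp

/-- Lower bound for the integral of `v₊^(p-1)` on a nonempty core. -/
lemma core_lower (hk : 0 < k) (hp : 1 < p) (hΩo : IsOpen Ω) (hΩb : Bornology.IsBounded Ω) :
    ∃ C : ℝ, 0 < C ∧ ∀ (q u : ℝ × ℝ → ℝ) (ε : ℝ), 0 < ε → ε < 1 →
    ContinuousOn q (closure Ω) → ContDiffOn ℝ 2 q Ω → (∀ x ∈ closure Ω, 0 < q x) →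
    (∀ x ∈ Ω, LH k q x = 0) → IsSolution k p ε q Ω u →
    (∃ x ∈ Ω, q x * Real.log (1 / ε) < u x) →
    ε ^ 2 ≤ C * ∫ x in Ω, pPart (u x - q x * Real.log (1 / ε)) ^ (p - 1) := by
  obtain ⟨C, hC, H⟩ := sobolev1 hk hΩo hΩb
  refine ⟨C * p, by positivity, fun q u ε hε hε1 hqc hq1 hq3 hq4 hs hne => ?_⟩
  obtain ⟨hc, hu, h0, hLu⟩ := hs
  have hL : 0 < Real.log (1 / ε) := Real.log_pos (by rw [one_div]; exact (one_lt_inv₀ hε).2 hε1)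
  set L := Real.log (1 / ε)
  have hA : Adm Ω (fun x => u x - q x * L) := adm_v hL hqc hq1 hq3 hc (hu.of_le (by norm_num)) h0
  have hP := prof_pow hp
  have h1 := H _ _ _ hP hA
  obtain ⟨iu, eu⟩ := test_prof hk hΩo hΩb hP hA hu
  obtain ⟨iq, eq⟩ := test_prof hk hΩo hΩb hP hA hq1
  obtain ⟨x0, hx0, hx0'⟩ := hne
  have hpos := int_sq_pos hΩo hΩb hA hP hx0 (by
    have : 0 < max (u x0 - q x0 * L) 0 := lt_max_of_lt_left (by linarith)
    positivity)
  have e1 : ∫ x in Ω, p * max (u x - q x * L) 0 ^ (p - 1) *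
      KHform k x (grad (fun x => u x - q x * L) x) (grad (fun x => u x - q x * L) x)
      = (1 / ε ^ 2) * ∫ x in Ω, (max (u x - q x * L) 0 ^ p) ^ 2 := by
    have e2 : ∫ x in Ω, max (u x - q x * L) 0 ^ p * LH k q x = 0 := by
      rw [setIntegral_congr_fun hΩo.measurableSet (g := fun _ => (0:ℝ))]
      · simp
      · intro x hx; simp [hq4 x hx]
    have e3 : ∫ x in Ω, max (u x - q x * L) 0 ^ p * LH k u x
        = (1 / ε ^ 2) * ∫ x in Ω, (max (u x - q x * L) 0 ^ p) ^ 2 := by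
      rw [← integral_const_mul]
      refine setIntegral_congr_fun hΩo.measurableSet fun x hx => ?_
      rw [hLu x hx, pPart]; ring
    have e4 := integral_sub iu (iq.const_mul L)
    rw [integral_const_mul, eq, e2, mul_zero, sub_zero, eu, e3] at e4
    rw [← e4]
    refine setIntegral_congr_fun hΩo.measurableSet fun x hx => ?_
    have hdu : DifferentiableAt ℝ u x :=
      (hu.contDiffAt (hΩo.mem_nhds hx)).differentiableAt (by norm_num)
    have hdq : DifferentiableAt ℝ q x :=
      (hq1.contDiffAt (hΩo.mem_nhds hx)).differentiableAt (by norm_num)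
    have eg : grad (fun x => u x - q x * L) x = grad u x - L • grad q x := by
      simp only [grad]
      rw [fderiv_fun_sub hdu (hdq.mul_const L), fderiv_mul_const hdq]
      simp
    have : KHform k x (grad (fun x => u x - q x * L) x) (grad (fun x => u x - q x * L) x)
      = KHform k x (grad u x) (grad (fun x => u x - q x * L) x)
        - L * KHform k x (grad q x) (grad (fun x => u x - q x * L) x) := by
      rw [← KHform_smul_left, ← KHform_sub_left, ← eg]
    simp only [this]
    ring
  rw [e1, integral_const_mul] at h1
  set S := ∫ x in Ω, (max (u x - q x * L) 0 ^ p) ^ 2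
  simp only [pPart]
  set J := ∫ x in Ω, max (u x - q x * L) 0 ^ (p - 1)
  have : S * ε ^ 2 ≤ S * (C * p * J) := by
    calc S * ε ^ 2 ≤ (C * (p * J * (1 / ε ^ 2 * S))) * ε ^ 2 := by gcongr
      _ = _ := by field_simp
  exact le_of_mul_le_mul_left this hpos

/-- energy lower bound. -/
lemma energy_lower (hk : 0 < k) (hp : 1 < p) (hΩo : IsOpen Ω) (hΩb : Bornology.IsBounded Ω)
    (hε : 0 < ε) (hε1 : ε < 1) (hqc : ContinuousOn q (closure Ω)) (hq1 : ContDiffOn ℝ 2 q Ω)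
    (hq3 : ∀ x ∈ closure Ω, 0 < q x) {a : ℝ} (hqa : ∀ x ∈ Ω, a ≤ q x)
    (hs : IsSolution k p ε q Ω u) (hm : MemH k Ω u) :
    (1 / 2) * Real.log (1 / ε) * a * (1 / ε ^ 2) *
      ∫ x in Ω, pPart (u x - q x * Real.log (1 / ε)) ^ p ≤ Ieps k p ε q Ω u := by
  obtain ⟨hc, hu, h0, hLu⟩ := hs
  obtain ⟨-, -, -, hint⟩ := hm
  have hL : 0 < Real.log (1 / ε) := Real.log_pos (by rw [one_div]; exact (one_lt_inv₀ hε).2 hε1)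
  rw [Ieps]
  set L := Real.log (1 / ε)
  have hA : Adm Ω (fun x => u x - q x * L) := adm_v hL hqc hq1 hq3 hc (hu.of_le (by norm_num)) h0
  have cu : ContinuousOn u Ω := hc.mono subset_closure
  have cq : ContinuousOn q Ω := hqc.mono subset_closure
  have cv : ∀ s : ℝ, 0 < s → ContinuousOn (fun x => pPart (u x - q x * L) ^ s) Ω := fun s hs =>
    ((continuous_id.max (continuous_const (y := (0:ℝ)))).comp_continuousOn
      (cu.sub (cq.mul continuousOn_const))).rpow_const
      (fun x _ => Or.inr hs.le)
  have zv : ∀ s : ℝ, 0 < s → ∀ x, u x - q x * L ≤ 0 → pPart (u x - q x * L) ^ s = 0 := by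
    intro s hs x hx; rw [pPart, max_eq_right hx, Real.zero_rpow hs.ne']
  have ip : IntegrableOn (fun x => pPart (u x - q x * L) ^ p) Ω :=
    hA.integrableOn hΩo hΩb (cv p (by linarith)) fun x _ hw => zv p (by linarith) x hw
  have ip1 : IntegrableOn (fun x => pPart (u x - q x * L) ^ (p + 1)) Ω :=
    hA.integrableOn hΩo hΩb (cv (p + 1) (by linarith)) fun x _ hw => zv (p + 1) (by linarith) x hw
  have ipu : IntegrableOn (fun x => pPart (u x - q x * L) ^ p * u x) Ω :=
    hA.integrableOn hΩo hΩb ((cv p (by linarith)).mul cu) fun x _ hw => by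
      rw [zv p (by linarith) x hw, zero_mul]
  set N := ∫ x in Ω, KHform k x (grad u x) (grad u x)
  -- N ≥ ε⁻² ∫ v₊^p u
  have hN : (1 / ε ^ 2) * ∫ x in Ω, pPart (u x - q x * L) ^ p * u x ≤ N := by
    set M := (1 / ε ^ 2) * ∫ x in Ω, pPart (u x - q x * L) ^ p with hM
    have hM0 : 0 ≤ M := by
      refine mul_nonneg (by positivity) (integral_nonneg fun x => ?_)
      exact Real.rpow_nonneg (le_max_right _ _) _
    have key : ∀ δ > 0, (1 / ε ^ 2) * ∫ x in Ω, pPart (u x - q x * L) ^ p * u x ≤ N + 2 * δ * M := by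
      intro δ hδ
      have hAδ : Adm Ω (fun x => u x - δ) :=
        ⟨hc.sub continuousOn_const, (hu.of_le (by norm_num)).sub contDiffOn_const,
          fun x hx => by rw [h0 x hx]; linarith⟩
      obtain ⟨i, e⟩ := test_prof hk hΩo hΩb (prof_sqrt hδ) hAδ hu
      rw [grad_sub_const] at i e
      have b1 := setIntegral_mono_on i hint hΩo.measurableSet fun x hx => by
        have := mul_le_mul_of_nonneg_right (prof_sqrt_le_one hδ (u x - δ))
          (KHform_self_nonneg hk x (grad u x))
        rwa [one_mul] at this
      rw [e] at b1
      have cP : Continuous (fun s => √(max s 0 ^ 2 + δ ^ 2) - δ) :=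
        (prof_sqrt hδ).contDiff.continuous
      have i2 : IntegrableOn (fun x => (√(max (u x - δ) 0 ^ 2 + δ ^ 2) - δ) * LH k u x) Ω := by
        have : IntegrableOn (fun x => (√(max (u x - δ) 0 ^ 2 + δ ^ 2) - δ) *
            ((1 / ε ^ 2) * pPart (u x - q x * L) ^ p)) Ω := by
          refine hA.integrableOn hΩo hΩb ?_ ?_
          · exact (cP.comp_continuousOn (cu.sub continuousOn_const)).mul
              (continuousOn_const.mul (cv p (by linarith)))
          · intro x _ hw; rw [zv p (by linarith) x hw]; simp
        exact this.congr_fun (fun x hx => by simp only [hLu x hx]) hΩo.measurableSet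
      have b2 : ∫ x in Ω, ((1 / ε ^ 2) * (pPart (u x - q x * L) ^ p * u x)
          - 2 * δ * ((1 / ε ^ 2) * pPart (u x - q x * L) ^ p)) ≤
          ∫ x in Ω, (√(max (u x - δ) 0 ^ 2 + δ ^ 2) - δ) * LH k u x := by
        refine setIntegral_mono_on ?_ i2 hΩo.measurableSet fun x hx => ?_
        · exact (ipu.const_mul _).sub ((ip.const_mul _).const_mul _)
        · rw [hLu x hx]
          have h1 := prof_sqrt_ge hδ (u x - δ)
          have h2 : 0 ≤ (1 / ε ^ 2) * pPart (u x - q x * L) ^ p :=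
            mul_nonneg (by positivity) (Real.rpow_nonneg (le_max_right _ _) _)
          have h3 := mul_le_mul_of_nonneg_right h1 h2
          show _ ≤ _ * (1 / ε ^ 2 * pPart (u x - q x * L) ^ p)
          linarith
      rw [integral_sub (ipu.const_mul _) ((ip.const_mul _).const_mul _), integral_const_mul,
        integral_const_mul, integral_const_mul, ← hM] at b2
      linarith
    refine le_of_forall_pos_le_add fun η hη => ?_
    have := key (η / (2 * (M + 1))) (by positivity)
    refine this.trans (add_le_add_right ?_ _)
    rw [show 2 * (η / (2 * (M + 1))) * M = η * (M / (M + 1)) by field_simp]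
    have : M / (M + 1) ≤ 1 := (div_le_one (by linarith)).2 (by linarith)
    nlinarith
  -- decomposition
  have hdec : (∫ x in Ω, pPart (u x - q x * L) ^ (p + 1)) + L * a * ∫ x in Ω, pPart (u x - q x * L) ^ p
      ≤ ∫ x in Ω, pPart (u x - q x * L) ^ p * u x := by
    rw [← integral_const_mul, ← integral_add ip1 (ip.const_mul _)]
    refine setIntegral_mono_on (ip1.add (ip.const_mul _)) ipu hΩo.measurableSet fun x hx => ?_
    by_cases hv : u x - q x * L ≤ 0
    · simp only [zv p (by linarith) x hv, zv (p + 1) (by linarith) x hv]; simp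
    · push Not at hv
      have e : pPart (u x - q x * L) = u x - q x * L := max_eq_left hv.le
      rw [e, Real.rpow_add_one hv.ne']
      have h1 : 0 ≤ (u x - q x * L) ^ p := Real.rpow_nonneg hv.le _
      have h2 := mul_le_mul_of_nonneg_right (mul_le_mul_of_nonneg_right (hqa x hx) hL.le) h1
      nlinarith
  have hp1 : (1 / ((p + 1) * ε ^ 2)) * (∫ x in Ω, pPart (u x - q x * L) ^ (p + 1))
      ≤ (1 / 2) * ((1 / ε ^ 2) * ∫ x in Ω, pPart (u x - q x * L) ^ (p + 1)) := by
    rw [← mul_assoc]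
    refine mul_le_mul_of_nonneg_right ?_ (integral_nonneg fun x =>
      Real.rpow_nonneg (le_max_right _ _) _)
    rw [show (1:ℝ) / 2 * (1 / ε ^ 2) = 1 / (2 * ε ^ 2) by field_simp]
    refine one_div_le_one_div_of_le (by positivity) ?_
    have := sq_nonneg ε
    nlinarith
  have := mul_le_mul_of_nonneg_left hdec (show 0 ≤ 1 / ε ^ 2 by positivity)
  rw [mul_add] at this
  linarith

end

/-! ### Mountain pass geometry -/

lemma young_rpow {t τ r j : ℝ} (ht : 0 ≤ t) (hτ : 0 < τ) (hr : 0 < r) (hj : 0 < j) :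
    t ^ r ≤ (τ ^ j)⁻¹ * t ^ (r + j) + τ ^ r := by
  rcases le_total t τ with h | h
  · have h1 : t ^ r ≤ τ ^ r := Real.rpow_le_rpow ht h hr.le
    have h2 : 0 ≤ (τ ^ j)⁻¹ * t ^ (r + j) := by positivity
    linarith
  · have h1 : τ ^ j ≤ t ^ j := Real.rpow_le_rpow hτ.le h hj.le
    have h2 : 0 < τ ^ j := by positivity
    have ht' : 0 < t := hτ.trans_le h
    rw [Real.rpow_add ht']
    have h3 : 1 ≤ (τ ^ j)⁻¹ * t ^ j := by rw [inv_mul_eq_div, le_div_iff₀ h2]; linarith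
    have h4 : 0 ≤ t ^ r := by positivity
    have h5 : 0 ≤ τ ^ r := by positivity
    nlinarith

def EN (k : ℝ) (Ω : Set (ℝ × ℝ)) (w : ℝ × ℝ → ℝ) : ℝ :=
  ∫ x in Ω, KHform k x (grad w x) (grad w x)

section
variable {k p ε : ℝ} {Ω : Set (ℝ × ℝ)} {q : ℝ × ℝ → ℝ}

lemma EN_nonneg (hk : 0 < k) (w : ℝ × ℝ → ℝ) : 0 ≤ EN k Ω w :=
  integral_nonneg fun _ => KHform_self_nonneg hk _ _

lemma pint_nonneg (w : ℝ × ℝ → ℝ) (c r : ℝ) : 0 ≤ ∫ x in Ω, pPart (w x - q x * c) ^ r :=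
  integral_nonneg fun _ => Real.rpow_nonneg (le_max_right _ _) _

lemma Ieps_le (hp : 1 < p) (w : ℝ × ℝ → ℝ) : Ieps k p ε q Ω w ≤ (1 / 2) * EN k Ω w := by
  have h := pint_nonneg (Ω := Ω) (q := q) w (Real.log (1 / ε)) (p + 1)
  have : 0 ≤ (1 / ((p + 1) * ε ^ 2)) * ∫ x in Ω, pPart (w x - q x * Real.log (1 / ε)) ^ (p + 1) :=
    mul_nonneg (by positivity) h
  rw [Ieps, EN]; linarith

lemma mp_local (hk : 0 < k) (hp : 1 < p) (hΩo : IsOpen Ω) (hΩb : Bornology.IsBounded Ω)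
    (hε : 0 < ε) (hε1 : ε < 1) (hqc : ContinuousOn q (closure Ω)) (hq1 : ContDiffOn ℝ 2 q Ω)
    (hq3 : ∀ x ∈ closure Ω, 0 < q x) {a : ℝ} (ha : 0 < a) (hqa : ∀ x ∈ Ω, a ≤ q x) :
    ∃ N0 : ℝ, 0 < N0 ∧ ∀ w, MemH k Ω w → EN k Ω w ≤ N0 → EN k Ω w / 4 ≤ Ieps k p ε q Ω w := by
  obtain ⟨C, hC, H⟩ := sobolev2 hk hΩo hΩb
  have hL : 0 < Real.log (1 / ε) := Real.log_pos (by rw [one_div]; exact (one_lt_inv₀ hε).2 hε1)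
  set m := (p + 1) / 2 with hm
  have hm1 : 1 < m := by rw [hm]; linarith
  set D := C * m ^ 2 with hD
  have hDp : 0 < D := by positivity
  set V := volume.real Ω with hV
  have hV0 : 0 ≤ V := measureReal_nonneg
  have hfin : volume Ω < ⊤ := hΩb.measure_lt_top
  set σ := (p + 1) * ε ^ 2 / (8 * D * (V + 1)) with hσ
  have hσp : 0 < σ := by positivity
  set τ := σ ^ (1 / (p - 1)) with hτ
  have hτp : 0 < τ := by positivity
  have hτσ : τ ^ (p - 1) = σ := by
    rw [hτ, ← Real.rpow_mul hσp.le, one_div, inv_mul_cancel₀ (by linarith), Real.rpow_one]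
  refine ⟨τ ^ (2:ℝ) / (2 * D), by positivity, fun w hw hN => ?_⟩
  obtain ⟨hc, hd, h0, hint⟩ := hw
  rw [Ieps]
  set L := Real.log (1 / ε)
  have hNn := EN_nonneg (Ω := Ω) hk w
  change EN k Ω w / 4 ≤ 1 / 2 * EN k Ω w - _
  have hA : Adm Ω (fun x => w x - a * L) :=
    ⟨hc.sub continuousOn_const, hd.sub contDiffOn_const, fun x hx => by
      rw [h0 x hx]; have := mul_pos ha hL; linarith⟩
  have hAv : Adm Ω (fun x => w x - q x * L) := adm_v hL hqc hq1 hq3 hc hd h0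
  have h1 := H _ _ _ (prof_pow hm1) hA (by rw [grad_sub_const]; exact hint)
  rw [grad_sub_const] at h1
  change _ ≤ C * (_ * EN k Ω w) at h1
  have cw : ContinuousOn w Ω := hc.mono subset_closure
  have cz : ∀ s : ℝ, 0 < s → ContinuousOn (fun x => max (w x - a * L) 0 ^ s) Ω := fun s hs =>
    ((continuous_id.max (continuous_const (y := (0:ℝ)))).comp_continuousOn
      (cw.sub continuousOn_const)).rpow_const (fun x _ => Or.inr hs.le)
  have iz : ∀ s : ℝ, 0 < s → IntegrableOn (fun x => max (w x - a * L) 0 ^ s) Ω := fun s hs =>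
    hA.integrableOn hΩo hΩb (cz s hs) fun x _ hw => by
      rw [max_eq_right hw, Real.zero_rpow hs.ne']
  have iv : IntegrableOn (fun x => pPart (w x - q x * L) ^ (p + 1)) Ω :=
    hAv.integrableOn hΩo hΩb (((continuous_id.max (continuous_const (y := (0:ℝ)))).comp_continuousOn
      (cw.sub ((hqc.mono subset_closure).mul continuousOn_const))).rpow_const
        (fun x _ => Or.inr (by linarith))) fun x _ hw => by
      rw [pPart, max_eq_right hw, Real.zero_rpow (by linarith)]
  set Z := ∫ x in Ω, max (w x - a * L) 0 ^ (p + 1) with hZ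
  have hZ0 : 0 ≤ Z := integral_nonneg fun x => by positivity
  have e1 : ∫ x in Ω, (max (w x - a * L) 0 ^ m) ^ 2 = Z := by
    refine setIntegral_congr_fun hΩo.measurableSet fun x _ => ?_
    rw [← Real.rpow_natCast, ← Real.rpow_mul (le_max_right _ _)]
    congr 1; rw [hm]; push_cast; ring
  have e2 : ∫ x in Ω, (m * max (w x - a * L) 0 ^ (m - 1)) ^ 2
      = m ^ 2 * ∫ x in Ω, max (w x - a * L) 0 ^ (p - 1) := by
    rw [← integral_const_mul]
    refine setIntegral_congr_fun hΩo.measurableSet fun x _ => ?_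
    rw [mul_pow]
    congr 1
    rw [← Real.rpow_natCast, ← Real.rpow_mul (le_max_right _ _)]
    congr 1; rw [hm]; push_cast; ring
  rw [e1, e2] at h1
  have y : ∫ x in Ω, max (w x - a * L) 0 ^ (p - 1) ≤ (τ ^ (2:ℝ))⁻¹ * Z + σ * V := by
    have : (τ ^ (2:ℝ))⁻¹ * Z + σ * V
        = ∫ x in Ω, ((τ ^ (2:ℝ))⁻¹ * max (w x - a * L) 0 ^ (p + 1) + σ) := by
      rw [integral_add ((iz (p + 1) (by linarith)).const_mul _)
        (integrableOn_const hfin.ne), integral_const_mul, setIntegral_const, smul_eq_mul, mul_comm V]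
    rw [this]
    refine setIntegral_mono_on (iz (p - 1) (by linarith))
      (((iz (p + 1) (by linarith)).const_mul _).add (integrableOn_const hfin.ne))
      hΩo.measurableSet fun x _ => ?_
    have := young_rpow (le_max_right (w x - a * L) 0) hτp (show 0 < p - 1 by linarith)
      (show (0:ℝ) < 2 by norm_num)
    rw [show p - 1 + 2 = p + 1 by ring, hτσ] at this
    exact this
  set N := EN k Ω w
  have hZle : Z ≤ 2 * D * σ * V * N := by
    have t2 : 0 < τ ^ (2:ℝ) := by positivity
    have a1 : Z ≤ D * N * ((τ ^ (2:ℝ))⁻¹ * Z + σ * V) := by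
      calc Z ≤ C * (m ^ 2 * (∫ x in Ω, max (w x - a * L) 0 ^ (p - 1)) * N) := h1
        _ ≤ C * (m ^ 2 * ((τ ^ (2:ℝ))⁻¹ * Z + σ * V) * N) := by gcongr
        _ = _ := by rw [hD]; ring
    have a2 : D * N * (τ ^ (2:ℝ))⁻¹ ≤ 1 / 2 := by
      rw [← div_eq_mul_inv, div_le_iff₀ t2]
      rw [le_div_iff₀ (by positivity)] at hN
      linarith
    nlinarith [mul_le_mul_of_nonneg_right a2 hZ0]
  have hle : ∫ x in Ω, pPart (w x - q x * L) ^ (p + 1) ≤ Z := by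
    refine setIntegral_mono_on iv (iz (p + 1) (by linarith)) hΩo.measurableSet fun x hx => ?_
    refine Real.rpow_le_rpow (le_max_right _ _) ?_ (by linarith)
    refine max_le_max ?_ le_rfl
    have := mul_le_mul_of_nonneg_right (hqa x hx) hL.le
    linarith
  have hfinal : 1 / ((p + 1) * ε ^ 2) * ∫ x in Ω, pPart (w x - q x * L) ^ (p + 1) ≤ N / 4 := by
    have b1 : 2 * D * σ * V * N ≤ (p + 1) * ε ^ 2 * (N / 4) := by
      have : 2 * D * σ * V = (p + 1) * ε ^ 2 / 4 * (V / (V + 1)) := by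
        rw [hσ]; field_simp; ring
      rw [this]
      have hv : V / (V + 1) ≤ 1 := (div_le_one (by linarith)).2 (by linarith)
      have : (p + 1) * ε ^ 2 / 4 * (V / (V + 1)) ≤ (p + 1) * ε ^ 2 / 4 * 1 := by
        gcongr
      calc _ ≤ (p + 1) * ε ^ 2 / 4 * 1 * N := by gcongr
        _ = _ := by ring
    rw [one_div, inv_mul_le_iff₀ (by positivity)]
    linarith
  linarith

lemma grad_sub_of {a b : ℝ × ℝ → ℝ} (hΩo : IsOpen Ω) (ha : ContDiffOn ℝ 1 a Ω)
    (hb : ContDiffOn ℝ 1 b Ω) {x : ℝ × ℝ} (hx : x ∈ Ω) :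
    grad (fun y => a y - b y) x = grad a x - grad b x := by
  simp only [grad]
  rw [fderiv_fun_sub ((ha.contDiffAt (hΩo.mem_nhds hx)).differentiableAt one_ne_zero)
    ((hb.contDiffAt (hΩo.mem_nhds hx)).differentiableAt one_ne_zero)]
  simp

lemma EN_diff (hk : 0 < k) (hΩo : IsOpen Ω) {a b : ℝ × ℝ → ℝ} (ha : MemH k Ω a) (hb : MemH k Ω b)
    {θ : ℝ} (hθ : 0 < θ) :
    |EN k Ω a - EN k Ω b| ≤ θ * EN k Ω b + (1 + θ⁻¹) * EN k Ω (fun y => a y - b y) := by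
  have ia := ha.2.2.2
  have ib := hb.2.2.2
  have hg := fun x (hx : x ∈ Ω) => grad_sub_of hΩo ha.2.1 hb.2.1 hx
  have iab : IntegrableOn (fun x => KHform k x (grad (fun y => a y - b y) x)
      (grad (fun y => a y - b y) x)) Ω := by
    refine Integrable.mono' ((ia.const_mul 2).add (ib.const_mul 2))
      ((continuousOn_KHself hk hΩo (ha.2.1.sub hb.2.1)).aestronglyMeasurable hΩo.measurableSet) ?_
    refine (ae_restrict_iff' hΩo.measurableSet).2 (Eventually.of_forall fun x hx => ?_)
    rw [Real.norm_of_nonneg (KHform_self_nonneg hk _ _), hg x hx]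
    have := KHform_self_nonneg hk x (grad a x + grad b x)
    simp only [KHform, Prod.fst_add, Prod.snd_add, Prod.fst_sub, Prod.snd_sub, Pi.add_apply] at this ⊢
    nlinarith
  have e1 : EN k Ω a ≤ (1 + θ) * EN k Ω b + (1 + θ⁻¹) * EN k Ω (fun y => a y - b y) := by
    simp only [EN]
    rw [← integral_const_mul, ← integral_const_mul,
      ← integral_add (ib.const_mul _) (iab.const_mul _)]
    refine setIntegral_mono_on ia ((ib.const_mul _).add (iab.const_mul _)) hΩo.measurableSet
      fun x hx => ?_
    rw [hg x hx]
    exact KHform_quad hk x _ _ hθ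
  have e2 : EN k Ω b ≤ (1 + θ) * EN k Ω a + (1 + θ⁻¹) * EN k Ω (fun y => a y - b y) := by
    simp only [EN]
    rw [← integral_const_mul, ← integral_const_mul,
      ← integral_add (ia.const_mul _) (iab.const_mul _)]
    refine setIntegral_mono_on ib ((ia.const_mul _).add (iab.const_mul _)) hΩo.measurableSet
      fun x hx => ?_
    rw [hg x hx]
    have h1 := KHform_quad hk x (grad b x) (grad a x) hθ
    have h2 : KHform k x (grad b x - grad a x) (grad b x - grad a x)
        = KHform k x (grad a x - grad b x) (grad a x - grad b x) := by
      simp only [KHform, Prod.fst_sub, Prod.snd_sub]; ring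
    rwa [h2] at h1
  have hD := EN_nonneg (Ω := Ω) hk (fun y => a y - b y)
  have hB := EN_nonneg (Ω := Ω) hk b
  set D := (1 + θ⁻¹) * EN k Ω (fun y => a y - b y)
  have hD' : 0 ≤ D := mul_nonneg (by positivity) hD
  rw [abs_le]
  constructor
  · by_contra hcon
    push Not at hcon
    have h3 := mul_lt_mul_of_pos_left hcon (show 0 < 1 + θ by linarith)
    nlinarith [mul_nonneg hθ.le hB, mul_nonneg hθ.le hD', mul_nonneg hθ.le (mul_nonneg hθ.le hB)]
  · linarith

/-- The set whose infimum is the mountain pass level. -/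
def mpSet (k p : ℝ) (q : ℝ × ℝ → ℝ) (Ω : Set (ℝ × ℝ)) (ε : ℝ) : Set ℝ :=
  {c | ∃ γ : ℝ → ℝ × ℝ → ℝ,
    (∀ t ∈ Icc (0:ℝ) 1, MemH k Ω (γ t)) ∧
    (∀ t ∈ Icc (0:ℝ) 1, ∀ δ > 0, ∃ η > 0, ∀ s ∈ Icc (0:ℝ) 1, |s - t| < η →
      EN k Ω (fun y => γ s y - γ t y) < δ) ∧
    γ 0 = (fun _ => 0) ∧ Ieps k p ε q Ω (γ 1) < 0 ∧
    c = sSup ((fun t => Ieps k p ε q Ω (γ t)) '' Icc (0:ℝ) 1)}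

lemma ceps_eq : ceps k p q Ω ε = sInf (mpSet k p q Ω ε) := rfl

lemma mp_lower (hk : 0 < k) (hp : 1 < p) (hΩo : IsOpen Ω) {N0 : ℝ} (hN0 : 0 < N0)
    (hloc : ∀ w, MemH k Ω w → EN k Ω w ≤ N0 → EN k Ω w / 4 ≤ Ieps k p ε q Ω w) :
    ∀ c ∈ mpSet k p q Ω ε, N0 / 4 ≤ c := by
  rintro c ⟨γ, hm, hcont, h0, h1, rfl⟩
  have hco : ContinuousOn (fun t => EN k Ω (γ t)) (Icc 0 1) := by
    rw [Metric.continuousOn_iff]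
    intro t ht η hη
    have hB := EN_nonneg (Ω := Ω) hk (γ t)
    set B := EN k Ω (γ t) with hBd
    set θ := η / (2 * (B + 1)) with hθ
    have hθp : 0 < θ := by positivity
    obtain ⟨δ, hδ, hδ2⟩ := hcont t ht (η / (2 * (1 + θ⁻¹))) (by positivity)
    refine ⟨δ, hδ, fun s hs hst => ?_⟩
    rw [Real.dist_eq] at hst ⊢
    have hD := hδ2 s hs hst
    refine (EN_diff hk hΩo (hm s hs) (hm t ht) hθp).trans_lt ?_
    rw [lt_div_iff₀ (by positivity)] at hD
    have : θ * B ≤ η / 2 := by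
      rw [hθ, div_mul_eq_mul_div, div_le_div_iff₀ (by positivity) (by norm_num)]
      nlinarith
    linarith
  have z0 : EN k Ω (γ 0) = 0 := by
    rw [h0]; simp [EN, grad, KHform]
  have z1 : N0 ≤ EN k Ω (γ 1) := by
    by_contra hcon
    push Not at hcon
    have h2 := hloc (γ 1) (hm 1 (by simp)) hcon.le
    have := EN_nonneg (Ω := Ω) hk (γ 1)
    linarith
  obtain ⟨t, ht, htN⟩ := intermediate_value_Icc zero_le_one hco
    (show N0 ∈ Icc (EN k Ω (γ 0)) (EN k Ω (γ 1)) from ⟨by rw [z0]; exact hN0.le, z1⟩)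
  simp only at htN
  have hI := hloc (γ t) (hm t ht) htN.le
  rw [htN] at hI
  refine hI.trans (le_csSup ?_ ⟨t, ht, rfl⟩)
  obtain ⟨M, hM⟩ := isCompact_Icc.bddAbove_image hco
  refine ⟨(1 / 2) * M, ?_⟩
  rintro _ ⟨s, hs, rfl⟩
  have := hM ⟨s, hs, rfl⟩
  have h3 := Ieps_le (k := k) (ε := ε) (q := q) (Ω := Ω) hp (γ s)
  simp only at this ⊢
  linarith

end

/-! ### Upper bound for the mountain pass level -/

lemma vol_closedBall_prod (x : ℝ × ℝ) {r : ℝ} (hr : 0 ≤ r) :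
    (volume : Measure (ℝ × ℝ)).real (Metric.closedBall x r) = (2 * r) ^ 2 := by
  rw [← closedBall_prod_same, Measure.volume_eq_prod, Measure.real, Measure.prod_prod,
    Real.volume_closedBall, Real.volume_closedBall, ENNReal.toReal_mul,
    ENNReal.toReal_ofReal (by positivity)]
  ring

lemma vol_ball_prod (x : ℝ × ℝ) {r : ℝ} (hr : 0 ≤ r) :
    (volume : Measure (ℝ × ℝ)).real (Metric.ball x r) = (2 * r) ^ 2 := by
  rw [← ball_prod_same, Measure.volume_eq_prod, Measure.real, Measure.prod_prod,
    Real.volume_ball, Real.volume_ball, ENNReal.toReal_mul,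
    ENNReal.toReal_ofReal (by positivity)]
  ring

lemma radial_integral {ε r : ℝ} (hε : 0 < ε) (hr : 0 < r) (x0 : ℝ × ℝ) :
    IntegrableOn (fun x : ℝ × ℝ => (ε ^ 2 + ‖x - x0‖ ^ 2)⁻¹) (Metric.ball x0 r) ∧
    ∫ x in Metric.ball x0 r, (ε ^ 2 + ‖x - x0‖ ^ 2)⁻¹
      = 4 * (Real.log (ε ^ 2 + r ^ 2) - Real.log (ε ^ 2)) := by
  constructor
  · refine IntegrableOn.mono_set (t := Metric.closedBall x0 r) ?_ Metric.ball_subset_closedBall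
    refine ContinuousOn.integrableOn_compact (isCompact_closedBall _ _) (Continuous.continuousOn ?_)
    refine Continuous.inv₀ (by fun_prop) fun x => by positivity
  · have e0 : ∫ x in Metric.ball x0 r, (ε ^ 2 + ‖x - x0‖ ^ 2)⁻¹
        = ∫ x : ℝ × ℝ, ((Iio r).indicator fun y => (ε ^ 2 + y ^ 2)⁻¹) ‖x‖ := by
      rw [← integral_indicator Metric.isOpen_ball.measurableSet, 
        ← integral_sub_right_eq_self
          (fun x : ℝ × ℝ => ((Iio r).indicator fun y => (ε ^ 2 + y ^ 2)⁻¹) ‖x‖) x0]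
      congr 1
    rw [e0, integral_fun_norm_addHaar, vol_ball_prod 0 zero_le_one]
    have e1 : ∫ y in Ioi (0:ℝ), y ^ (Module.finrank ℝ (ℝ × ℝ) - 1) •
        ((Iio r).indicator fun y => (ε ^ 2 + y ^ 2)⁻¹) y = ∫ y in (0:ℝ)..r, y * (ε ^ 2 + y ^ 2)⁻¹ := by
      rw [intervalIntegral.integral_of_le hr.le, integral_Ioc_eq_integral_Ioo,
        ← integral_indicator measurableSet_Ioi, ← integral_indicator measurableSet_Ioo]
      congr 1; funext y
      by_cases h : 0 < y <;> by_cases h' : y < r <;> simp [indicator, h, h']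
    rw [e1]
    have e2 : ∫ y in (0:ℝ)..r, y * (ε ^ 2 + y ^ 2)⁻¹
        = 1 / 2 * Real.log (ε ^ 2 + r ^ 2) - 1 / 2 * Real.log (ε ^ 2 + 0 ^ 2) := by
      refine intervalIntegral.integral_eq_sub_of_hasDerivAt
        (f := fun y => 1 / 2 * Real.log (ε ^ 2 + y ^ 2)) (fun y _ => ?_)
        (Continuous.intervalIntegrable ?_ _ _)
      · have h1 : HasDerivAt (fun y : ℝ => ε ^ 2 + y ^ 2) (2 * y) y := by
          simpa using (hasDerivAt_pow 2 y).const_add (ε ^ 2)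
        have h2 := (h1.log (by positivity)).const_mul (1 / 2 : ℝ)
        exact h2.congr_deriv (by ring)
      · exact continuous_id.mul (Continuous.inv₀ (by fun_prop) fun x => by positivity)
    have e3 : Module.finrank ℝ (ℝ × ℝ) = 2 := by simp
    rw [e2, e3, nsmul_eq_mul, smul_eq_mul, zero_pow two_ne_zero, add_zero]
    push_cast
    ring

lemma log_bump {ε r : ℝ} (hε : 0 < ε) (hr : 0 < r) (x0 : ℝ × ℝ) :
    ∃ φ : ℝ × ℝ → ℝ, ContDiff ℝ 1 φ ∧ (∀ x, 0 ≤ φ x) ∧ (∀ x, r ≤ ‖x - x0‖ → φ x = 0) ∧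
      (∀ x, r ≤ ‖x - x0‖ → grad φ x = 0) ∧
      (∀ x, (grad φ x).1 ^ 2 + (grad φ x).2 ^ 2 ≤ (ε ^ 2 + ‖x - x0‖ ^ 2)⁻¹) ∧
      (∀ x, ‖x - x0‖ < ε → 1 / 2 * Real.log (r ^ 2 / (3 * ε ^ 2)) - 1 ≤ φ x) := by
  set s : ℝ × ℝ → ℝ := fun x => ε ^ 2 + (x.1 - x0.1) ^ 2 + (x.2 - x0.2) ^ 2 with hs
  have hsp : ∀ x, 0 < s x := fun x => by simp only [hs]; positivity
  set ψ : ℝ × ℝ → ℝ := fun x => 1 / 2 * (Real.log (r ^ 2) - Real.log (s x)) with hψ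
  have hP := prof_sqrt one_pos
  set P : ℝ → ℝ := fun s => √(max s 0 ^ 2 + 1 ^ 2) - 1 with hPd
  set P' : ℝ → ℝ := fun s => max s 0 / √(max s 0 ^ 2 + 1 ^ 2) with hPd'
  have hsc : ContDiff ℝ 1 s := by simp only [hs]; fun_prop
  have hψc : ContDiff ℝ 1 ψ :=
    contDiff_const.mul (contDiff_const.sub (hsc.log fun x => (hsp x).ne'))
  have n1 : ∀ x, ‖x - x0‖ ^ 2 ≤ (x.1 - x0.1) ^ 2 + (x.2 - x0.2) ^ 2 := fun x => by
    rw [Prod.norm_def]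
    rcases max_choice ‖(x - x0).1‖ ‖(x - x0).2‖ with h | h <;> rw [h] <;>
      simp only [Prod.fst_sub, Prod.snd_sub, Real.norm_eq_abs, sq_abs] <;> nlinarith [sq_nonneg (x.1 - x0.1), sq_nonneg (x.2 - x0.2)]
  have hneg : ∀ x, r ≤ ‖x - x0‖ → ψ x ≤ 0 := fun x hx => by
    have : r ^ 2 ≤ s x := by
      have := n1 x; simp only [hs]; nlinarith
    have := Real.log_le_log (by positivity) this
    simp only [hψ]; linarith
  have hg : ∀ x, grad (fun x => P (ψ x)) x
      = (-(P' (ψ x) * (x.1 - x0.1) / s x), -(P' (ψ x) * (x.2 - x0.2) / s x)) := fun x => by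
    have h1 : HasFDerivAt (fun x : ℝ × ℝ => (x.1 - x0.1)) (ContinuousLinearMap.fst ℝ ℝ ℝ) x :=
      hasFDerivAt_fst.sub_const _
    have h2 : HasFDerivAt (fun x : ℝ × ℝ => (x.2 - x0.2)) (ContinuousLinearMap.snd ℝ ℝ ℝ) x :=
      hasFDerivAt_snd.sub_const _
    have h3 := ((h1.pow 2).const_add (ε ^ 2)).add (h2.pow 2)
    have h3' : HasFDerivAt s _ x := h3
    have h4 := ((h3'.log (hsp x).ne').const_sub (Real.log (r ^ 2))).const_mul (1 / 2 : ℝ)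
    have h4' : HasFDerivAt ψ _ x := h4
    have h5 := (hP.hd (ψ x)).comp_hasFDerivAt x h4'
    have h6 : fderiv ℝ (fun x => P (ψ x)) x = _ := h5.fderiv
    rw [grad, h6]
    have := (hsp x).ne'
    ext <;> simp <;> field_simp
  refine ⟨fun x => P (ψ x), hP.contDiff.comp hψc, fun x => prof_sqrt_nonneg one_pos _,
    fun x hx => hP.h0 _ (hneg x hx), fun x hx => ?_, fun x => ?_, fun x hx => ?_⟩
  · rw [hg, hP.h0' _ (hneg x hx)]; simp
  · rw [hg]
    have h1 : P' (ψ x) ≤ 1 := prof_sqrt_le_one one_pos _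
    have h0 := hP.hn (ψ x)
    have h2 : P' (ψ x) ^ 2 ≤ 1 := by nlinarith
    have h3 := hsp x
    have h4 : (s x)⁻¹ ≤ (ε ^ 2 + ‖x - x0‖ ^ 2)⁻¹ := by
      refine inv_anti₀ (by positivity) ?_
      have := n1 x; simp only [hs]; linarith
    refine le_trans ?_ h4
    have e : (-(P' (ψ x) * (x.1 - x0.1) / s x)) ^ 2 + (-(P' (ψ x) * (x.2 - x0.2) / s x)) ^ 2
      = P' (ψ x) ^ 2 * ((x.1 - x0.1) ^ 2 + (x.2 - x0.2) ^ 2) / (s x) ^ 2 := by ring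
    simp only
    rw [e, inv_eq_one_div, div_le_div_iff₀ (by positivity) h3]
    have h5 : (x.1 - x0.1) ^ 2 + (x.2 - x0.2) ^ 2 ≤ s x := by
      simp only [hs]; nlinarith [sq_nonneg ε]
    have h6 : P' (ψ x) ^ 2 * ((x.1 - x0.1) ^ 2 + (x.2 - x0.2) ^ 2) ≤ 1 * s x :=
      mul_le_mul h2 h5 (by positivity) zero_le_one
    nlinarith
  · refine le_trans ?_ (prof_sqrt_ge one_pos (ψ x))
    have a1 : |x.1 - x0.1| < ε := (norm_fst_le (x - x0)).trans_lt hx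
    have a2 : |x.2 - x0.2| < ε := (norm_snd_le (x - x0)).trans_lt hx
    have b1 : (x.1 - x0.1) ^ 2 ≤ ε ^ 2 := sq_le_sq' (by linarith [(abs_lt.1 a1).1]) (abs_lt.1 a1).2.le
    have b2 : (x.2 - x0.2) ^ 2 ≤ ε ^ 2 := sq_le_sq' (by linarith [(abs_lt.1 a2).1]) (abs_lt.1 a2).2.le
    have : Real.log (s x) ≤ Real.log (3 * ε ^ 2) :=
      Real.log_le_log (hsp x) (by simp only [hs]; linarith)
    rw [Real.log_div (by positivity) (by positivity)]
    simp only [hψ]; linarith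

lemma grad_const_mul {φ : ℝ × ℝ → ℝ} (hφ : ContDiff ℝ 1 φ) (c : ℝ) (x : ℝ × ℝ) :
    grad (fun y => c * φ y) x = c • grad φ x := by
  have hd : DifferentiableAt ℝ φ x := hφ.differentiable one_ne_zero x
  have := (hd.hasFDerivAt.const_mul c).fderiv
  rw [grad, this, grad]
  simp

lemma EN_const_mul {k : ℝ} {Ω : Set (ℝ × ℝ)} {φ : ℝ × ℝ → ℝ} (hφ : ContDiff ℝ 1 φ) (c : ℝ) :
    EN k Ω (fun y => c * φ y) = c ^ 2 * EN k Ω φ := by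
  rw [EN, EN, ← integral_const_mul]
  congr 1; funext x
  rw [grad_const_mul hφ, KHform_smul_self]

lemma mp_upper_aux {k p ε r b : ℝ} {Ω : Set (ℝ × ℝ)} {q : ℝ × ℝ → ℝ} {x0 : ℝ × ℝ}
    (hk : 0 < k) (hp : 1 < p) (hΩo : IsOpen Ω) (hΩb : Bornology.IsBounded Ω)
    (hqc : ContinuousOn q (closure Ω)) (hb : 0 ≤ b) (hqb : ∀ x ∈ Ω, q x ≤ b)
    (hr : 0 < r) (hr1 : r < 1) (hball : Metric.closedBall x0 r ⊆ Ω)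
    (hε : 0 < ε) (hεr : ε < r) {L : ℝ} (hL : L = Real.log (1 / ε)) (hL1 : 1 ≤ L)
    (hL2 : 1 + 1 / 2 * Real.log 3 - Real.log r ≤ L / 2)
    (hL3 : 6 * (2 * (b + 1)) ^ 2 * (p + 1) / 4 < L) :
    ∃ c ∈ mpSet k p q Ω ε, c ≤ 6 * (2 * (b + 1)) ^ 2 * L := by
  obtain ⟨φ, hφ, hφ0, hφz, hgz, hgb, hφe⟩ := log_bump hε hr x0
  have hbo : Metric.ball x0 r ⊆ Ω := Metric.ball_subset_closedBall.trans hball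
  have hlogε : Real.log ε = -L := by rw [hL, one_div, Real.log_inv, neg_neg]
  have hEN : EN k Ω φ ≤ 12 * L := by
    obtain ⟨i1, i2⟩ := radial_integral hε hr x0
    have e1 : EN k Ω φ ≤ ∫ x in Ω,
        (Metric.ball x0 r).indicator (fun x : ℝ × ℝ => (ε ^ 2 + ‖x - x0‖ ^ 2)⁻¹) x := by
      refine integral_mono_of_nonneg (Eventually.of_forall fun x => KHform_self_nonneg hk _ _)
        ((integrable_indicator_iff Metric.isOpen_ball.measurableSet).2 i1).integrableOn
        (Eventually.of_forall fun x => ?_)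
      by_cases h : x ∈ Metric.ball x0 r
      · simp only [indicator_of_mem h]
        exact (KHform_self_le hk _ _).trans (hgb x)
      · simp only [indicator_of_notMem h]
        rw [Metric.mem_ball, dist_eq_norm, not_lt] at h
        rw [hgz x h]; simp [KHform]
    rw [setIntegral_indicator Metric.isOpen_ball.measurableSet, inter_eq_self_of_subset_right hbo,
      i2, Real.log_pow, hlogε] at e1
    have : Real.log (ε ^ 2 + r ^ 2) ≤ 1 := by
      have h1 := Real.log_le_sub_one_of_pos (show 0 < ε ^ 2 + r ^ 2 by positivity)
      nlinarith
    push_cast at e1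
    linarith
  have hEN0 := EN_nonneg (Ω := Ω) hk φ
  have hmem : ∀ c : ℝ, MemH k Ω (fun x => c * φ x) := fun c => by
    have hc : ContDiff ℝ 1 (fun x => c * φ x) := contDiff_const.mul hφ
    refine ⟨hc.continuous.continuousOn, hc.contDiffOn, fun x hx => ?_, ?_⟩
    · change c * φ x = 0
      rw [hφz x, mul_zero]
      by_contra h
      rw [not_le, ← dist_eq_norm] at h
      have h2 := hbo (Metric.mem_ball.2 h)
      rw [hΩo.frontier_eq] at hx
      exact hx.2 h2
    · refine integrableOn_of_core hΩo (isCompact_closedBall x0 r) hball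
        (continuousOn_KHself hk hΩo hc.contDiffOn) fun x _ hx => ?_
      rw [Metric.mem_closedBall, dist_eq_norm, not_le] at hx
      rw [grad_const_mul hφ, hgz x hx.le]; simp [KHform]
  set T := 2 * (b + 1) with hT
  have hIle : ∀ c : ℝ, Ieps k p ε q Ω (fun x => c * φ x) ≤ 6 * c ^ 2 * L := fun c => by
    have := Ieps_le (k := k) (ε := ε) (q := q) (Ω := Ω) hp (fun x => c * φ x)
    rw [EN_const_mul hφ] at this
    nlinarith [sq_nonneg c]
  have hneg : Ieps k p ε q Ω (fun x => T * φ x) < 0 := by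
    have hsub : Metric.ball x0 ε ⊆ Ω := (Metric.ball_subset_ball hεr.le).trans hbo
    have hco : ContinuousOn (fun x => pPart (T * φ x - q x * L) ^ (p + 1)) (closure Ω) :=
      ((continuous_id.max (continuous_const (y := (0:ℝ)))).comp_continuousOn
        (((continuous_const.mul hφ.continuous).continuousOn).sub
          (hqc.mul continuousOn_const))).rpow_const fun x _ => Or.inr (by linarith)
    have hI : IntegrableOn (fun x => pPart (T * φ x - q x * L) ^ (p + 1)) Ω :=
      (hco.integrableOn_compact hΩb.isCompact_closure).mono_set subset_closure
    have h1 : 4 * ε ^ 2 * L ^ (p + 1) ≤ ∫ x in Ω, pPart (T * φ x - q x * L) ^ (p + 1) := by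
      calc 4 * ε ^ 2 * L ^ (p + 1) = ∫ x in Metric.ball x0 ε, L ^ (p + 1) := by
            rw [setIntegral_const, vol_ball_prod x0 hε.le, smul_eq_mul]; ring
        _ ≤ ∫ x in Metric.ball x0 ε, pPart (T * φ x - q x * L) ^ (p + 1) := by
            refine setIntegral_mono_on (integrableOn_const (by exact measure_ball_lt_top.ne))
              (hI.mono_set hsub) Metric.isOpen_ball.measurableSet fun x hx => ?_
            refine Real.rpow_le_rpow (by linarith) ?_ (by linarith)
            refine le_trans ?_ (le_max_left _ _)
            have h2 := hφe x (by rwa [← dist_eq_norm])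
            rw [Real.log_div (by positivity) (by positivity), Real.log_mul (by norm_num)
              (by positivity), Real.log_pow, Real.log_pow, hlogε] at h2
            push_cast at h2
            have h3 : L / 2 ≤ φ x := by linarith
            have h4 := hqb x (hsub hx)
            have h5 : T * (L / 2) ≤ T * φ x := mul_le_mul_of_nonneg_left h3 (by positivity)
            have h6 : q x * L ≤ b * L := mul_le_mul_of_nonneg_right h4 (by linarith)
            have h7 : T * (L / 2) = (b + 1) * L := by rw [hT]; ring
            linarith
        _ ≤ _ := setIntegral_mono_set hI
            (Eventually.of_forall fun x => Real.rpow_nonneg (le_max_right _ _) _)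
            hsub.eventuallyLE
    have h2 : 1 / ((p + 1) * ε ^ 2) * (4 * ε ^ 2 * L ^ (p + 1)) ≤
        1 / ((p + 1) * ε ^ 2) * ∫ x in Ω, pPart (T * φ x - q x * L) ^ (p + 1) :=
      mul_le_mul_of_nonneg_left h1 (by have : 0 < p + 1 := by linarith
                                       positivity)
    have h3 : 1 / ((p + 1) * ε ^ 2) * (4 * ε ^ 2 * L ^ (p + 1)) = 4 / (p + 1) * (L ^ p * L) := by
      rw [Real.rpow_add_one (by linarith)]; field_simp
    have h4 : L ≤ L ^ p := by
      have := Real.rpow_le_rpow_of_exponent_le hL1 hp.le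
      rwa [Real.rpow_one] at this
    have h5 : 6 * T ^ 2 * L < 4 / (p + 1) * (L ^ p * L) := by
      have hp1 : 0 < p + 1 := by linarith
      have h6 : 6 * T ^ 2 < 4 / (p + 1) * L ^ p := by
        rw [div_mul_eq_mul_div, lt_div_iff₀ hp1]
        linarith
      rw [← mul_assoc]
      exact mul_lt_mul_of_pos_right h6 (by linarith)
    have h6 : EN k Ω (fun x => T * φ x) ≤ T ^ 2 * (12 * L) := by
      rw [EN_const_mul hφ]; exact mul_le_mul_of_nonneg_left hEN (sq_nonneg _)
    rw [EN] at h6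
    rw [Ieps, ← hL]
    linarith
  refine ⟨_, ⟨fun t x => (t * T) * φ x, fun t _ => hmem _, fun t _ δ hδ => ?_, ?_, ?_, rfl⟩, ?_⟩
  · set M := T ^ 2 * EN k Ω φ + 1 with hM
    have hM0 : 0 < M := by positivity
    refine ⟨√(δ / M), Real.sqrt_pos.2 (by positivity), fun s _ hst => ?_⟩
    have e : (fun y => s * T * φ y - t * T * φ y) = fun y => ((s - t) * T) * φ y := by
      funext y; ring
    have h1 : |s - t| ^ 2 < δ / M := by
      have := Real.sq_sqrt (show 0 ≤ δ / M by positivity)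
      nlinarith [abs_nonneg (s - t), Real.sqrt_nonneg (δ / M)]
    rw [sq_abs, lt_div_iff₀ hM0] at h1
    simp only [e]
    rw [EN_const_mul hφ]
    nlinarith [sq_nonneg (s - t)]
  · funext x; simp
  · simp only [one_mul]; exact hneg
  · refine csSup_le ((nonempty_Icc.2 zero_le_one).image _) ?_
    rintro _ ⟨t, ht, rfl⟩
    refine (hIle (t * T)).trans ?_
    have : (t * T) ^ 2 ≤ T ^ 2 := by
      rw [mul_pow]
      have : t ^ 2 ≤ 1 := by nlinarith [ht.1, ht.2]
      nlinarith [sq_nonneg T]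
    nlinarith

lemma log_inv_atTop : Tendsto (fun ε : ℝ => Real.log (1 / ε)) (𝓝[>] 0) atTop := by
  simp only [one_div]
  exact Real.tendsto_log_atTop.comp tendsto_inv_nhdsGT_zero

lemma mp_upper {k p b : ℝ} {Ω : Set (ℝ × ℝ)} {q : ℝ × ℝ → ℝ}
    (hk : 0 < k) (hp : 1 < p) (hΩo : IsOpen Ω) (hΩb : Bornology.IsBounded Ω) (hne : Ω.Nonempty)
    (hqc : ContinuousOn q (closure Ω)) (hb : 0 ≤ b) (hqb : ∀ x ∈ Ω, q x ≤ b) :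
    ∃ C : ℝ, 0 < C ∧ ∀ᶠ ε in 𝓝[>] (0:ℝ), ∃ c ∈ mpSet k p q Ω ε, c ≤ C * Real.log (1 / ε) := by
  obtain ⟨x0, hx0⟩ := hne
  obtain ⟨r0, hr0, hb0⟩ := Metric.isOpen_iff.1 hΩo x0 hx0
  set r := min (r0 / 2) (1 / 2) with hr
  have hrp : 0 < r := by positivity
  have hr1 : r < 1 := (min_le_right _ _).trans_lt (by norm_num)
  have hball : Metric.closedBall x0 r ⊆ Ω :=
    (Metric.closedBall_subset_ball ((min_le_left _ _).trans_lt (by linarith))).trans hb0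
  refine ⟨6 * (2 * (b + 1)) ^ 2, by positivity, ?_⟩
  filter_upwards [self_mem_nhdsWithin, mem_nhdsWithin_of_mem_nhds (Iio_mem_nhds hrp),
    log_inv_atTop.eventually_ge_atTop 1,
    log_inv_atTop.eventually_ge_atTop (2 * (1 + 1 / 2 * Real.log 3 - Real.log r)),
    log_inv_atTop.eventually_gt_atTop (6 * (2 * (b + 1)) ^ 2 * (p + 1) / 4)] with ε h1 h2 h3 h4 h5
  exact mp_upper_aux hk hp hΩo hΩb hqc hb hqb hrp hr1 hball h1 h2 rfl h3 (by linarith) h5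

/-! ### Conclusion -/

lemma vol_le_diamE {S : Set (ℝ × ℝ)} (hS : Bornology.IsBounded S) (hne : S.Nonempty) :
    0 ≤ diamE S ∧ (volume : Measure (ℝ × ℝ)).real S ≤ (2 * diamE S) ^ 2 := by
  obtain ⟨R, hR⟩ := hS.exists_norm_le
  have hbdd : BddAbove {d | ∃ a ∈ S, ∃ b ∈ S, d = dE a b} := by
    refine ⟨√((2 * R) ^ 2 + (2 * R) ^ 2), ?_⟩
    rintro _ ⟨a, ha, b, hb, rfl⟩
    have a1 := abs_le.1 ((norm_fst_le a).trans (hR a ha))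
    have a2 := abs_le.1 ((norm_snd_le a).trans (hR a ha))
    have b1 := abs_le.1 ((norm_fst_le b).trans (hR b hb))
    have b2 := abs_le.1 ((norm_snd_le b).trans (hR b hb))
    refine Real.sqrt_le_sqrt (add_le_add ?_ ?_)
    · exact sq_le_sq' (by linarith [a1.1, b1.2]) (by linarith [a1.2, b1.1])
    · exact sq_le_sq' (by linarith [a2.1, b2.2]) (by linarith [a2.2, b2.1])
  obtain ⟨a0, ha0⟩ := hne
  have hd : ∀ x ∈ S, dE x a0 ≤ diamE S := fun x hx => le_csSup hbdd ⟨x, hx, a0, ha0, rfl⟩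
  have h0 : 0 ≤ diamE S := (Real.sqrt_nonneg _).trans (hd a0 ha0)
  refine ⟨h0, ?_⟩
  rw [← vol_closedBall_prod a0 h0]
  refine measureReal_mono (fun x hx => ?_) measure_closedBall_lt_top.ne
  rw [Metric.mem_closedBall, dist_eq_norm, Prod.norm_def]
  refine le_trans (max_le ?_ ?_) (hd x hx)
  · exact Real.abs_le_sqrt (by simp only [Prod.fst_sub]; nlinarith [sq_nonneg (x.2 - a0.2)])
  · exact Real.abs_le_sqrt (by simp only [Prod.snd_sub]; nlinarith [sq_nonneg (x.1 - a0.1)])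

lemma final_step {p ε a C C1 : ℝ} {Ω : Set (ℝ × ℝ)} {q u : ℝ × ℝ → ℝ} (hp : 1 < p)
    (hΩo : IsOpen Ω) (hΩb : Bornology.IsBounded Ω) (hqc : ContinuousOn q (closure Ω))
    (huc : ContinuousOn u (closure Ω)) (hε : 0 < ε) (hL : 0 < Real.log (1 / ε)) (ha : 0 < a)
    (hC : 0 < C) (hC1 : 0 < C1)
    (h1 : (1 / 2) * Real.log (1 / ε) * a * (1 / ε ^ 2) *
      ∫ x in Ω, pPart (u x - q x * Real.log (1 / ε)) ^ p ≤ C * Real.log (1 / ε))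
    (h2 : ε ^ 2 ≤ C1 * ∫ x in Ω, pPart (u x - q x * Real.log (1 / ε)) ^ (p - 1))
    (hA : ∃ x ∈ Ω, q x * Real.log (1 / ε) < u x) :
    √(1 / (8 * C1 * (2 * C1 * (2 * C / a)) ^ (p - 1))) * ε ≤ diamE (vcore q Ω ε u) := by
  set L := Real.log (1 / ε)
  set A := vcore q Ω ε u with hAd
  set τ := 2 * C1 * (2 * C / a) with hτ
  have hτ0 : 0 < τ := by positivity
  have hAΩ : A ⊆ Ω := fun x hx => hx.1
  have hAo : IsOpen A := by
    have : A = Ω ∩ (fun x => u x - q x * L) ⁻¹' (Ioi 0) := by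
      ext x
      change (x ∈ Ω ∧ q x * L < u x) ↔ (x ∈ Ω ∧ 0 < u x - q x * L)
      rw [sub_pos]
    rw [this]
    exact ((huc.sub (hqc.mul continuousOn_const)).mono subset_closure).isOpen_inter_preimage
      hΩo isOpen_Ioi
  have hint : ∀ s : ℝ, 0 ≤ s → IntegrableOn (fun x => pPart (u x - q x * L) ^ s) Ω := fun s hs =>
    ((((continuous_id.max (continuous_const (y := (0:ℝ)))).comp_continuousOn
      (huc.sub (hqc.mul continuousOn_const))).rpow_const
        fun x _ => Or.inr hs).integrableOn_compact hΩb.isCompact_closure).mono_set subset_closure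
  obtain ⟨d0, hd⟩ := vol_le_diamE (hΩb.subset hAΩ) (by obtain ⟨x, h, h'⟩ := hA; exact ⟨x, h, h'⟩)
  set D := diamE A
  have hfin : volume A ≠ ⊤ := (hΩb.subset hAΩ).measure_lt_top.ne
  have hi2 : IntegrableOn (A.indicator fun _ => τ ^ (p - 1)) Ω :=
    ((integrable_indicator_iff hAo.measurableSet).2 (integrableOn_const hfin)).integrableOn
  have h3 : ∫ x in Ω, pPart (u x - q x * L) ^ (p - 1) ≤
      τ⁻¹ * (∫ x in Ω, pPart (u x - q x * L) ^ p) + volume.real A * τ ^ (p - 1) := by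
    have e : volume.real A * τ ^ (p - 1) = ∫ x in Ω, (A.indicator fun _ => τ ^ (p - 1)) x := by
      rw [setIntegral_indicator hAo.measurableSet, inter_eq_self_of_subset_right hAΩ,
        setIntegral_const, smul_eq_mul]
    rw [e, ← integral_const_mul, ← integral_add ((hint p (by linarith)).const_mul _) hi2]
    refine setIntegral_mono_on (hint _ (by linarith))
      (((hint p (by linarith)).const_mul _).add hi2) hΩo.measurableSet fun x hx => ?_
    by_cases h : x ∈ A
    · rw [indicator_of_mem h]
      have := young_rpow (t := pPart (u x - q x * L)) (le_max_right _ _) hτ0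
        (show 0 < p - 1 by linarith) one_pos
      rwa [Real.rpow_one, sub_add_cancel] at this
    · rw [indicator_of_notMem h]
      have hz : pPart (u x - q x * L) = 0 := by
        refine max_eq_right ?_
        by_contra hcon
        exact h ⟨hx, by change q x * L < u x; linarith⟩
      rw [hz, Real.zero_rpow (by linarith), Real.zero_rpow (by linarith)]; simp
  set J := ∫ x in Ω, pPart (u x - q x * L) ^ p
  have h4 : J ≤ 2 * C / a * ε ^ 2 := by
    have e : 1 / 2 * L * a * (1 / ε ^ 2) * J = (1 / 2 * a * J / ε ^ 2) * L := by ring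
    rw [e] at h1
    have h5 := le_of_mul_le_mul_right h1 hL
    rw [div_le_iff₀ (by positivity)] at h5
    rw [div_mul_eq_mul_div, le_div_iff₀ ha]
    linarith
  have h5 : C1 * (τ⁻¹ * J) ≤ ε ^ 2 / 2 := by
    calc C1 * (τ⁻¹ * J) ≤ C1 * (τ⁻¹ * (2 * C / a * ε ^ 2)) := by gcongr
      _ = ε ^ 2 / 2 := by rw [hτ]; field_simp
  have h6 : ε ^ 2 ≤ C1 * (τ⁻¹ * J) + C1 * ((2 * D) ^ 2 * τ ^ (p - 1)) := by
    rw [← mul_add]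
    refine h2.trans (mul_le_mul_of_nonneg_left (h3.trans ?_) hC1.le)
    have : volume.real A * τ ^ (p - 1) ≤ (2 * D) ^ 2 * τ ^ (p - 1) :=
      mul_le_mul_of_nonneg_right hd (by positivity)
    linarith
  have hB0 : 0 < 8 * C1 * τ ^ (p - 1) := by positivity
  refine (sq_le_sq₀ (by positivity) d0).1 ?_
  rw [mul_pow, Real.sq_sqrt (by positivity), div_mul_eq_mul_div, div_le_iff₀ hB0]
  nlinarith

/-- Lemma 3.4: lower bound for the diameter of the vortex core:
there is `R₁ > 0` independent of `ε` with `diam(A_ε) ≥ R₁ ε`. -/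
theorem statement12 (k p : ℝ) (hk : 0 < k) (hp : 1 < p)
    (Ω : Set (ℝ × ℝ)) (hΩo : IsOpen Ω) (hΩc : IsConnected Ω)
    (hΩb : Bornology.IsBounded Ω) (hΩsc : SimplyConnectedSpace ↥Ω)
    (q : ℝ × ℝ → ℝ) (hq1 : ContDiffOn ℝ 2 q Ω) (hq2 : ContDiffOn ℝ 1 q (closure Ω))
    (hq3 : ∀ x ∈ closure Ω, 0 < q x) (hq4 : ∀ x ∈ Ω, LH k q x = 0)
    (hmin : ∃ x0 ∈ closure Ω, x0.2 = 0 ∧ ∀ y ∈ closure Ω, Qfun k q x0 ≤ Qfun k q y)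
    (u : ℝ → ℝ × ℝ → ℝ)
    (hu : ∀ ε ∈ Set.Ioo (0:ℝ) 1, IsMPSolution k p ε q Ω (u ε))
    :
    ∃ R₁ > (0:ℝ), ∀ᶠ ε in 𝓝[>] (0:ℝ), R₁ * ε ≤ diamE (vcore q Ω ε (u ε)) := by
  have hqc := hq2.continuousOn
  have hne := hΩc.nonempty
  have hK := hΩb.isCompact_closure
  obtain ⟨xm, hxm, hmn⟩ := hK.exists_isMinOn hne.closure hqc
  obtain ⟨xM, hxM, hmx⟩ := hK.exists_isMaxOn hne.closure hqc
  have ha : 0 < q xm := hq3 xm hxm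
  have hqa : ∀ x ∈ Ω, q xm ≤ q x := fun x hx => hmn (subset_closure hx)
  have hqb : ∀ x ∈ Ω, q x ≤ q xM := fun x hx => hmx (subset_closure hx)
  obtain ⟨C, hC, hup⟩ := mp_upper hk hp hΩo hΩb hne hqc (hq3 xM hxM).le hqb
  obtain ⟨C1, hC1, hcore⟩ := core_lower hk hp hΩo hΩb
  set C' := 2 * C / q xm with hC'
  have hC'0 : 0 < C' := by positivity
  set τ := 2 * C1 * C' with hτ
  have hτ0 : 0 < τ := by positivity
  set B := 8 * C1 * τ ^ (p - 1) with hB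
  have hB0 : 0 < B := by positivity
  refine ⟨√(1 / B), Real.sqrt_pos.2 (by positivity), ?_⟩
  filter_upwards [self_mem_nhdsWithin, mem_nhdsWithin_of_mem_nhds (Iio_mem_nhds one_pos), hup]
    with ε hε hε1 hc
  have hε : 0 < ε := hε
  have hε1 : ε < 1 := hε1
  obtain ⟨c, hcm, hcC⟩ := hc
  obtain ⟨hs, hm, hI⟩ := hu ε ⟨hε, hε1⟩
  obtain ⟨N0, hN0, hloc⟩ := mp_local hk hp hΩo hΩb hε hε1 hqc hq1 hq3 ha hqa
  have hlow := mp_lower hk hp hΩo hN0 hloc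
  have hcpos : 0 < Ieps k p ε q Ω (u ε) := by
    rw [hI, ceps_eq]
    exact lt_of_lt_of_le (by positivity) (le_csInf ⟨c, hcm⟩ hlow)
  have hcle : Ieps k p ε q Ω (u ε) ≤ C * Real.log (1 / ε) := by
    rw [hI, ceps_eq]
    exact (csInf_le ⟨N0 / 4, hlow⟩ hcm).trans hcC
  have hA : ∃ x ∈ Ω, q x * Real.log (1 / ε) < u ε x := by
    by_contra hcon
    push Not at hcon
    exact hcpos.ne (energy_zero_of_empty hk hp hΩo hΩb hs hcon).symm
  have hlow2 := energy_lower hk hp hΩo hΩb hε hε1 hqc hq1 hq3 hqa hs hm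
  have hcl := hcore q (u ε) ε hε hε1 hqc hq1 hq3 hq4 hs hA
  have hL : 0 < Real.log (1 / ε) := Real.log_pos (by rw [one_div]; exact (one_lt_inv₀ hε).2 hε1)
  exact final_step hp hΩo hΩb hqc hs.1 hε hL ha hC hC1 (hlow2.trans hcle) hcl hA
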